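/- Let z be a real algebraic irrational number and s > 2 a real number. Then the series ∑_{n=1}^∞ sec(πnz)/n^s converges absolutely. -/

import Mathlib

namespace RothAux

open MvPolynomial

abbrev MP (m : ℕ) := MvPolynomial (Fin m) ℝ

/-- Divided (Hasse) derivative of multi-order `μ`. -/
noncomputable def D {m : ℕ} (μ : Fin m →₀ ℕ) : MP m →ₗ[ℝ] MP m :=
  (basisMonomials (Fin m) ℝ).constr ℝ
    (fun a => monomial (a - μ) (∏ i, ((a i).choose (μ i) : ℝ)))

lemma D_monomial {m : ℕ} (μ a : Fin m →₀ ℕ) (c : ℝ) :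
    D μ (monomial a c) = monomial (a - μ) (c * ∏ i, ((a i).choose (μ i) : ℝ)) := by
  have h1 : (monomial a c : MP m) = c • (basisMonomials (Fin m) ℝ) a := by
    simp [smul_monomial]
  rw [h1, map_smul, D, Module.Basis.constr_basis, smul_monomial, smul_eq_mul]

lemma coeff_D {m : ℕ} (μ b : Fin m →₀ ℕ) (f : MP m) :
    coeff b (D μ f) = coeff (b + μ) f * ∏ i, ((b i + μ i).choose (μ i) : ℝ) := by
  induction f using MvPolynomial.induction_on' with
  | monomial a c =>
    rw [D_monomial, coeff_monomial, coeff_monomial]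
    by_cases h : a = b + μ
    · subst h
      simp
    · rw [if_neg h, zero_mul]
      split_ifs with h2
      · have : ∃ i, a i < μ i := by
          by_contra hcon
          push Not at hcon
          apply h
          rw [← h2]
          exact (tsub_add_cancel_of_le (show μ ≤ a from hcon)).symm
        obtain ⟨i, hi⟩ := this
        rw [Finset.prod_eq_zero (Finset.mem_univ i) (by simp [Nat.choose_eq_zero_of_lt hi]),
          mul_zero]
      · rfl
  | add p q hp hq => simp [hp, hq, add_mul]

lemma D_zero {m : ℕ} (f : MP m) : D 0 f = f := by
  ext b
  simp [coeff_D]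

lemma pderiv_D {m : ℕ} (h : Fin m) (μ : Fin m →₀ ℕ) (f : MP m) :
    pderiv h (D μ f) = ((μ h : ℝ) + 1) • D (μ + Finsupp.single h 1) f := by
  ext b
  rw [coeff_pderiv, coeff_D, coeff_smul, coeff_D, smul_eq_mul]
  have e : b + Finsupp.single h 1 + μ = b + (μ + Finsupp.single h 1) := by abel
  rw [e]
  obtain ⟨ν, hν⟩ : ∃ ν, ν = μ + Finsupp.single h 1 := ⟨_, rfl⟩
  rw [← hν]
  rw [← Finset.mul_prod_erase _ _ (Finset.mem_univ h)]
  rw [← Finset.mul_prod_erase _ (fun i => (((b i + ν i).choose (ν i) : ℕ) : ℝ))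
    (Finset.mem_univ h)]
  have e2 : ∏ x ∈ Finset.univ.erase h, ((((b + Finsupp.single h 1 : Fin m →₀ ℕ) x + μ x).choose (μ x) : ℕ) : ℝ)
      = ∏ x ∈ Finset.univ.erase h, (((b x + ν x).choose (ν x) : ℕ) : ℝ) := by
    apply Finset.prod_congr rfl
    intro x hx
    have : x ≠ h := (Finset.ne_of_mem_erase hx)
    simp [hν, this]
  rw [e2]
  have e3 : ((((b + Finsupp.single h 1 : Fin m →₀ ℕ) h + μ h).choose (μ h) : ℕ) : ℝ) * ((b h : ℝ) + 1)
      = ((μ h : ℝ) + 1) * (((b h + ν h).choose (ν h) : ℕ) : ℝ) := by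
    simp only [hν, Finsupp.add_apply, Finsupp.single_eq_same]
    have := Nat.choose_succ_right_eq (b h + 1 + μ h) (μ h)
    have h3 : b h + 1 + μ h - μ h = b h + 1 := by omega
    rw [h3] at this
    have h4 : b h + (μ h + 1) = b h + 1 + μ h := by ring
    rw [h4]
    have h5 := congrArg (Nat.cast (R := ℝ)) this
    push_cast at h5 ⊢
    linarith
  linear_combination (coeff (b + ν) f) *
    (∏ x ∈ Finset.univ.erase h, (((b x + ν x).choose (ν x) : ℕ) : ℝ)) * e3

lemma D_succ {m : ℕ} (h : Fin m) (μ : Fin m →₀ ℕ) (f : MP m) :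
    D (μ + Finsupp.single h 1) f = ((μ h : ℝ) + 1)⁻¹ • pderiv h (D μ f) := by
  rw [pderiv_D, smul_smul, inv_mul_cancel₀ (by positivity), one_smul]

/-- induction on multi-indices, one unit at a time -/
lemma multi_induction {m : ℕ} {p : (Fin m →₀ ℕ) → Prop} (h0 : p 0)
    (hs : ∀ μ h, p μ → p (μ + Finsupp.single h 1)) (μ : Fin m →₀ ℕ) : p μ := by
  induction μ using Finsupp.induction with
  | zero => exact h0
  | single_add a b f _ _ ih =>
    clear * - ih hs
    induction b with
    | zero => simpa using ih
    | succ b ihb =>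
      have := hs _ a ihb
      have e : Finsupp.single a b + f + Finsupp.single a 1 = Finsupp.single a (b + 1) + f := by
        rw [Finsupp.single_add]; abel
      rwa [e] at this

/-- Taylor shift -/
noncomputable def T {m : ℕ} (β : Fin m → ℝ) : MP m →ₐ[ℝ] MP m :=
  aeval (fun i => X i + C (β i))

lemma pderiv_T {m : ℕ} (β : Fin m → ℝ) (h : Fin m) (f : MP m) :
    pderiv h (T β f) = T β (pderiv h f) := by
  induction f using MvPolynomial.induction_on with
  | C a => simp [T]
  | add p q hp hq => simp [hp, hq]
  | mul_X p i hp =>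
    rw [map_mul, Derivation.leibniz, Derivation.leibniz, hp]
    simp only [smul_eq_mul, map_add, map_mul]
    congr 1
    simp only [T, aeval_X, map_add, pderiv_C, pderiv_X, add_zero]
    by_cases hh : i = h
    · subst hh; simp
    · simp [hh]

lemma D_T {m : ℕ} (β : Fin m → ℝ) (μ : Fin m →₀ ℕ) (f : MP m) :
    D μ (T β f) = T β (D μ f) := by
  induction μ using multi_induction with
  | h0 => simp [D_zero]
  | hs μ h ih => rw [D_succ, D_succ, ih, pderiv_T, map_smul]

lemma coeff_zero_T {m : ℕ} (β : Fin m → ℝ) (f : MP m) : coeff 0 (T β f) = eval β f := by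
  have : (constantCoeff.comp (T β).toRingHom) = eval β := by
    ext i
    · simp [T]
    · simp [T]
  exact congrArg (fun φ => φ f) this

lemma coeff_T {m : ℕ} (β : Fin m → ℝ) (μ : Fin m →₀ ℕ) (f : MP m) :
    coeff μ (T β f) = eval β (D μ f) := by
  rw [← coeff_zero_T, ← D_T, coeff_D]
  simp

/-- coefficient-wise ℓ¹ norm -/
noncomputable def L1 {m : ℕ} (f : MP m) : ℝ := ∑ a ∈ f.support, |coeff a f|

lemma L1_eq_sum {m : ℕ} (f : MP m) (s : Finset (Fin m →₀ ℕ)) (hs : f.support ⊆ s) :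
    L1 f = ∑ a ∈ s, |coeff a f| := by
  apply Finset.sum_subset hs
  intro x _ hx
  simp [notMem_support_iff.mp hx]

lemma sum_le_L1 {m : ℕ} (f : MP m) (s : Finset (Fin m →₀ ℕ)) :
    ∑ a ∈ s, |coeff a f| ≤ L1 f := by
  classical
  rw [L1_eq_sum f (f.support ∪ s) Finset.subset_union_left]
  exact Finset.sum_le_sum_of_subset_of_nonneg Finset.subset_union_right (fun _ _ _ => abs_nonneg _)

lemma L1_nonneg {m : ℕ} (f : MP m) : 0 ≤ L1 f := Finset.sum_nonneg (fun _ _ => abs_nonneg _)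

lemma L1_add {m : ℕ} (f g : MP m) : L1 (f + g) ≤ L1 f + L1 g := by
  classical
  rw [L1_eq_sum f (f.support ∪ g.support) Finset.subset_union_left,
    L1_eq_sum g (f.support ∪ g.support) Finset.subset_union_right,
    L1_eq_sum (f + g) (f.support ∪ g.support) support_add, ← Finset.sum_add_distrib]
  exact Finset.sum_le_sum (fun a _ => by rw [coeff_add]; exact abs_add_le _ _)

lemma L1_zero {m : ℕ} : L1 (0 : MP m) = 0 := by simp [L1]

lemma L1_sum {m : ℕ} {ι : Type*} (s : Finset ι) (f : ι → MP m) :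
    L1 (∑ i ∈ s, f i) ≤ ∑ i ∈ s, L1 (f i) :=
  Finset.le_sum_of_subadditive _ L1_zero.le L1_add s f

lemma L1_monomial_mul {m : ℕ} (a : Fin m →₀ ℕ) (c : ℝ) (g : MP m) :
    L1 (monomial a c * g) ≤ |c| * L1 g := by
  classical
  have hsub : (monomial a c * g).support ⊆ g.support.image (a + ·) := by
    intro x hx
    rw [mem_support_iff, coeff_monomial_mul'] at hx
    split_ifs at hx with hax
    · rw [Finset.mem_image]
      refine ⟨x - a, ?_, add_tsub_cancel_of_le hax⟩
      rw [mem_support_iff]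
      exact right_ne_zero_of_mul hx
    · exact absurd rfl hx
  rw [L1_eq_sum _ _ hsub, Finset.sum_image (fun x _ y _ h => add_left_cancel h), L1,
    Finset.mul_sum]
  apply Finset.sum_le_sum
  intro x _
  rw [coeff_monomial_mul, abs_mul]

lemma L1_mul {m : ℕ} (f g : MP m) : L1 (f * g) ≤ L1 f * L1 g := by
  conv_lhs => rw [f.as_sum, Finset.sum_mul]
  refine (L1_sum _ _).trans ?_
  conv_rhs => rw [L1, Finset.sum_mul]
  exact Finset.sum_le_sum (fun a _ => L1_monomial_mul _ _ _)

lemma L1_monomial {m : ℕ} (a : Fin m →₀ ℕ) (c : ℝ) : L1 (monomial a c : MP m) ≤ |c| := by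
  rw [L1_eq_sum (monomial a c) {a} support_monomial_subset]
  simp

lemma L1_one {m : ℕ} : L1 (1 : MP m) ≤ 1 := by
  have := L1_monomial (m := m) 0 1
  simpa using this

lemma L1_prod {m : ℕ} {ι : Type*} (s : Finset ι) (f : ι → MP m) :
    L1 (∏ i ∈ s, f i) ≤ ∏ i ∈ s, L1 (f i) := by
  classical
  induction s using Finset.induction_on with
  | empty => simpa using L1_one
  | insert a s ha ih =>
    rw [Finset.prod_insert ha, Finset.prod_insert ha]
    exact (L1_mul _ _).trans (mul_le_mul_of_nonneg_left ih (L1_nonneg _))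

lemma L1_pow {m : ℕ} (f : MP m) (k : ℕ) : L1 (f ^ k) ≤ L1 f ^ k := by
  have := L1_prod (Finset.range k) (fun _ => f)
  simpa using this

lemma L1_C_mul {m : ℕ} (c : ℝ) (f : MP m) : L1 (C c * f) ≤ |c| * L1 f := L1_monomial_mul 0 c f

end RothAux

namespace RothAux

open MvPolynomial

lemma coeff_X_mul_pderiv {m : ℕ} (h : Fin m) (f : MP m) (e : Fin m →₀ ℕ) :
    coeff e (X h * pderiv h f) = (e h : ℝ) * coeff e f := by
  induction f using MvPolynomial.induction_on' with
  | monomial a c =>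
    rw [X_mul_pderiv_monomial, coeff_smul, coeff_monomial]
    split_ifs with hh
    · subst hh; simp
    · simp
  | add p q hp hq => simp only [map_add, mul_add, coeff_add, hp, hq]

lemma const_ratio {m : ℕ} (a b : MP m) (hb : b ≠ 0)
    (hab : ∀ h, a * pderiv h b = b * pderiv h a) : ∃ c : ℝ, a = C c * b := by
  classical
  set o := MonomialOrder.lex (σ := Fin m)
  set β := o.degree b with hβ
  have hbβ : coeff β b ≠ 0 := o.coeff_degree_ne_zero_iff.mpr hb
  refine ⟨coeff β a / coeff β b, ?_⟩
  set c := coeff β a / coeff β b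
  by_contra hne
  set a' := a - C c * b with ha'
  have ha0 : a' ≠ 0 := sub_ne_zero.mpr hne
  set α := o.degree a' with hα
  have haα : coeff α a' ≠ 0 := o.coeff_degree_ne_zero_iff.mpr ha0
  have hz : coeff β a' = 0 := by
    simp only [ha', coeff_sub, coeff_C_mul, c]
    field_simp
    simp
  have hrel : ∀ h, a' * (X h * pderiv h b) = b * (X h * pderiv h a') := by
    intro h
    have := hab h
    simp only [ha', map_sub, pderiv_C_mul]
    linear_combination (X h) * this
  have hdeg : ∀ (f : MP m) (h : Fin m), o.toSyn (o.degree (X h * pderiv h f)) ≤ o.toSyn (o.degree f) := by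
    intro f h
    rw [o.degree_le_iff]
    intro e he
    apply o.le_degree
    rw [mem_support_iff, coeff_X_mul_pderiv] at he
    rw [mem_support_iff]
    exact right_ne_zero_of_mul he
  have : α = β := by
    ext h
    have h1 := congrArg (coeff (α + β)) (hrel h)
    rw [o.coeff_mul_of_add_of_degree_le (le_refl _) (hdeg b h), add_comm α β,
      o.coeff_mul_of_add_of_degree_le (le_refl _) (hdeg a' h), coeff_X_mul_pderiv,
      coeff_X_mul_pderiv] at h1
    have h2 : coeff α a' * coeff β b * ((α h : ℝ) - β h) = 0 := by
      linear_combination -h1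
    rcases mul_eq_zero.mp h2 with h3 | h3
    · exact absurd h3 (mul_ne_zero haα hbβ)
    · exact_mod_cast sub_eq_zero.mp h3
  rw [this] at haα
  exact haα hz

lemma wronskian_aux {m : ℕ} (s : ℕ) : ∀ (f : Fin s → MP m), LinearIndependent ℝ f →
    ∀ (a : Fin s → MP m), (∀ ν : Fin m →₀ ℕ, ν.degree < s → ∑ j, a j * D ν (f j) = 0) →
    a = 0 := by
  induction s with
  | zero => intro f _ a _; ext j; exact j.elim0
  | succ s ih =>
    intro f hf a ha
    have hf' : LinearIndependent ℝ (f ∘ Fin.castSucc) :=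
      hf.comp _ (Fin.castSucc_injective s)
    by_cases hb : a (Fin.last s) = 0
    · have := ih _ hf' (a ∘ Fin.castSucc) (by
        intro ν hν
        have := ha ν (by omega)
        rw [Fin.sum_univ_castSucc, hb, zero_mul, add_zero] at this
        exact this)
      funext j
      refine Fin.lastCases hb (fun i => ?_) j
      exact congrFun this i
    · exfalso
      set b := a (Fin.last s) with hbdef
      have key : ∀ h : Fin m, ∀ j, a j * pderiv h b = b * pderiv h (a j) := by
        intro h
        have hder : ∀ ν : Fin m →₀ ℕ, ν.degree < s → ∑ j, pderiv h (a j) * D ν (f j) = 0 := by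
          intro ν hν
          have h1 := congrArg (pderiv h) (ha ν (by omega))
          rw [map_sum, map_zero] at h1
          simp only [Derivation.leibniz, smul_eq_mul, pderiv_D] at h1
          rw [Finset.sum_add_distrib] at h1
          have h2 : ∑ x, a x * ((ν h : ℝ) + 1) • D (ν + Finsupp.single h 1) (f x) = 0 := by
            have := ha (ν + Finsupp.single h 1) (by simp [Finsupp.degree_single]; omega)
            simp only [mul_smul_comm, ← Finset.smul_sum, this, smul_zero]
          rw [h2, zero_add] at h1
          rw [← h1]
          exact Finset.sum_congr rfl (fun _ _ => mul_comm _ _)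
        have := ih _ hf' (fun j => b * pderiv h (a j.castSucc) - a j.castSucc * pderiv h b) (by
          intro ν hν
          have h1 := hder ν hν
          have h2 := ha ν (by omega)
          rw [Fin.sum_univ_castSucc] at h1 h2
          simp only [sub_mul, Finset.sum_sub_distrib, Function.comp]
          have e1 : ∑ x : Fin s, b * pderiv h (a x.castSucc) * D ν (f x.castSucc)
            = b * ∑ x : Fin s, pderiv h (a x.castSucc) * D ν (f x.castSucc) := by
            rw [Finset.mul_sum]; exact Finset.sum_congr rfl (fun _ _ => by ring)
          have e2 : ∑ x : Fin s, a x.castSucc * pderiv h b * D ν (f x.castSucc)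
            = pderiv h b * ∑ x : Fin s, a x.castSucc * D ν (f x.castSucc) := by
            rw [Finset.mul_sum]; exact Finset.sum_congr rfl (fun _ _ => by ring)
          rw [e1, e2]
          linear_combination b * h1 - pderiv h b * h2)
        intro j
        refine Fin.lastCases rfl (fun i => ?_) j
        have h3 := congrFun this i
        simp only [Pi.zero_apply] at h3
        linear_combination -h3
      have hc : ∀ j, ∃ c : ℝ, a j = C c * b := fun j => const_ratio _ _ hb (fun h => key h j)
      choose c hc using hc
      have h0 := ha 0 (by simp)
      have h1 : b * ∑ j, c j • f j = 0 := by
        rw [← h0, Finset.mul_sum]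
        refine Finset.sum_congr rfl (fun j _ => ?_)
        rw [hc j, D_zero, smul_eq_C_mul]; ring
      have h2 := (mul_eq_zero.mp h1).resolve_left hb
      have h3 := Fintype.linearIndependent_iff.mp hf c h2 (Fin.last s)
      have h4 := hc (Fin.last s)
      rw [h3, map_zero, zero_mul] at h4
      exact hb h4

lemma exists_det_ne_zero {R : Type*} [CommRing R] [IsDomain R] {ι : Type*} {s : ℕ}
    (v : ι → Fin s → R) (h : ∀ a : Fin s → R, (∀ i, ∑ j, a j * v i j = 0) → a = 0) :
    ∃ μ : Fin s → ι, (Matrix.of fun i j => v (μ i) j).det ≠ 0 := by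
  classical
  let K := FractionRing R
  let w : ι → Fin s → K := fun i j => algebraMap R K (v i j)
  have hspan : Submodule.span K (Set.range w) = ⊤ := by
    by_contra hne
    obtain ⟨φ, hφ, hle⟩ := Submodule.exists_le_ker_of_lt_top _ (lt_top_iff_ne_top.2 hne)
    apply hφ
    obtain ⟨b, hb⟩ := IsLocalization.exist_integer_multiples_of_finite (nonZeroDivisors R)
      (fun j : Fin s => φ (Pi.single j 1))
    choose a ha using hb
    have ha0 : a = 0 := by
      apply h
      intro i
      have h1 : φ (w i) = 0 := hle (Submodule.subset_span ⟨i, rfl⟩)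
      rw [LinearMap.pi_apply_eq_sum_univ φ (w i)] at h1
      apply IsFractionRing.injective R K
      rw [map_zero, map_sum]
      have h2 : ∑ x, algebraMap R K (a x * v i x) = (b : R) • ∑ x, w i x • φ (fun j => if x = j then 1 else 0) := by
        rw [Finset.smul_sum]
        refine Finset.sum_congr rfl (fun x _ => ?_)
        rw [map_mul, ha x]
        have : (Pi.single x 1 : Fin s → K) = fun j => if x = j then 1 else 0 := by
          ext j; simp [Pi.single_apply, eq_comm]
        rw [this, Algebra.smul_def, Algebra.smul_def, smul_eq_mul]
        ring
      rw [h2, h1, smul_zero]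
    apply LinearMap.pi_ext'
    intro j
    ext
    have h3 := ha j
    rw [ha0] at h3
    simp only [Pi.zero_apply, map_zero, Algebra.smul_def] at h3
    have h4 : algebraMap R K (b : R) ≠ 0 := by
      rw [Ne, IsFractionRing.to_map_eq_zero_iff]
      exact nonZeroDivisors.coe_ne_zero b
    have := (mul_eq_zero.mp h3.symm).resolve_left h4
    simpa using this
  obtain ⟨κ, a, ha, hsp, hli⟩ := exists_linearIndependent' K w
  rw [hspan] at hsp
  let B := Module.Basis.mk hli hsp.ge
  haveI : Fintype κ := FiniteDimensional.fintypeBasisIndex B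
  have hcard : Fintype.card κ = s := by
    rw [← Module.finrank_eq_card_basis B]; simp
  let e : Fin s ≃ κ := (Fintype.equivFinOfCardEq hcard).symm
  refine ⟨fun i => a (e i), ?_⟩
  intro hdet
  have h5 : LinearIndependent K (Matrix.of fun i j => w (a (e i)) j).row := by
    exact hli.comp _ e.injective
  rw [Matrix.linearIndependent_rows_iff_isUnit, Matrix.isUnit_iff_isUnit_det] at h5
  apply h5.ne_zero
  have := congrArg (algebraMap R K) hdet
  rw [RingHom.map_det, map_zero] at this
  exact this

/-- Nonvanishing of a generalized Wronskian. -/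
lemma wronskian {m s : ℕ} (f : Fin s → MP m) (hf : LinearIndependent ℝ f) :
    ∃ μ : Fin s → (Fin m →₀ ℕ), (∀ i, (μ i).degree < s) ∧
      (Matrix.of fun i j => D (μ i) (f j)).det ≠ 0 := by
  obtain ⟨μ, hμ⟩ := exists_det_ne_zero
    (fun (ν : {ν : Fin m →₀ ℕ // ν.degree < s}) (j : Fin s) => D ν.1 (f j))
    (fun a ha => wronskian_aux s f hf a (fun ν hν => ha ⟨ν, hν⟩))
  exact ⟨fun i => (μ i).1, fun i => (μ i).2, hμ⟩

end RothAux

namespace RothAux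

open MvPolynomial

/-! ### weights -/

/-- every monomial of `f` has `w`-weight at least `t` -/
def GE {m : ℕ} (w : (Fin m →₀ ℕ) →+ ℝ) (t : ℝ) (f : MP m) : Prop :=
  ∀ a, coeff a f ≠ 0 → t ≤ w a

lemma GE.add {m : ℕ} {w : (Fin m →₀ ℕ) →+ ℝ} {t : ℝ} {f g : MP m} (hf : GE w t f)
    (hg : GE w t g) : GE w t (f + g) := by
  intro a ha
  rw [coeff_add] at ha
  by_cases h : coeff a f = 0
  · exact hg a (by simpa [h] using ha)
  · exact hf a h

lemma GE.zero {m : ℕ} {w : (Fin m →₀ ℕ) →+ ℝ} {t : ℝ} : GE w t (0 : MP m) := by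
  intro a ha; simp at ha

lemma GE.neg {m : ℕ} {w : (Fin m →₀ ℕ) →+ ℝ} {t : ℝ} {f : MP m} (hf : GE w t f) :
    GE w t (-f) := by
  intro a ha
  exact hf a (by simpa using ha)

lemma GE.smul {m : ℕ} {w : (Fin m →₀ ℕ) →+ ℝ} {t : ℝ} {f : MP m} (c : ℝ) (hf : GE w t f) :
    GE w t (c • f) := by
  intro a ha
  rw [coeff_smul, smul_eq_mul] at ha
  exact hf a (right_ne_zero_of_mul ha)

lemma GE.mul {m : ℕ} {w : (Fin m →₀ ℕ) →+ ℝ} {t u : ℝ} {f g : MP m} (hf : GE w t f)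
    (hg : GE w u g) : GE w (t + u) (f * g) := by
  classical
  intro a ha
  rw [coeff_mul] at ha
  obtain ⟨x, hx, hx2⟩ := Finset.exists_ne_zero_of_sum_ne_zero ha
  rw [Finset.HasAntidiagonal.mem_antidiagonal] at hx
  rw [← hx, map_add]
  exact add_le_add (hf _ (left_ne_zero_of_mul hx2)) (hg _ (right_ne_zero_of_mul hx2))

lemma GE.sum {m : ℕ} {w : (Fin m →₀ ℕ) →+ ℝ} {t : ℝ} {ι : Type*} (s : Finset ι) {f : ι → MP m}
    (hf : ∀ i ∈ s, GE w t (f i)) : GE w t (∑ i ∈ s, f i) := by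
  classical
  induction s using Finset.induction_on with
  | empty => simpa using GE.zero
  | insert a s ha ih =>
    rw [Finset.sum_insert ha]
    exact (hf a (Finset.mem_insert_self _ _)).add
      (ih (fun i hi => hf i (Finset.mem_insert_of_mem hi)))

lemma GE.prod {m : ℕ} {w : (Fin m →₀ ℕ) →+ ℝ} {ι : Type*} (s : Finset ι) {t : ι → ℝ}
    {f : ι → MP m} (hf : ∀ i ∈ s, GE w (t i) (f i)) : GE w (∑ i ∈ s, t i) (∏ i ∈ s, f i) := by
  classical
  induction s using Finset.induction_on with
  | empty =>
    intro a ha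
    rw [Finset.prod_empty, coeff_one] at ha
    have : a = 0 := by by_contra h; exact ha (if_neg (Ne.symm h))
    simp [this]
  | insert a s ha ih =>
    rw [Finset.sum_insert ha, Finset.prod_insert ha]
    exact (hf a (Finset.mem_insert_self _ _)).mul
      (ih (fun i hi => hf i (Finset.mem_insert_of_mem hi)))

lemma GE.det {m s : ℕ} {w : (Fin m →₀ ℕ) →+ ℝ} {t : Fin s → ℝ} {A : Matrix (Fin s) (Fin s) (MP m)}
    (hA : ∀ i j, GE w (t j) (A i j)) : GE w (∑ j, t j) A.det := by
  rw [Matrix.det_apply]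
  apply GE.sum
  intro σ _
  have h1 : GE w (∑ j, t j) (∏ j, A (σ j) j) := GE.prod _ (fun j _ => hA _ _)
  rcases Int.units_eq_one_or (Equiv.Perm.sign σ) with h | h
  · rw [h, one_smul]; exact h1
  · rw [h, Units.neg_smul, one_smul]; exact h1.neg

/-- minus the exponent of the variable `h` -/
noncomputable def negDeg {m : ℕ} (h : Fin m) : (Fin m →₀ ℕ) →+ ℝ where
  toFun a := -(a h : ℝ)
  map_zero' := by simp
  map_add' a b := by simp; ring

/-- degree in variable `h` at most `r` -/
def DegLE {m : ℕ} (h : Fin m) (r : ℕ) (f : MP m) : Prop := GE (negDeg h) (-(r : ℝ)) f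

lemma degLE_iff {m : ℕ} {h : Fin m} {r : ℕ} {f : MP m} :
    DegLE h r f ↔ ∀ a, coeff a f ≠ 0 → a h ≤ r := by
  unfold DegLE GE negDeg
  simp

lemma DegLE.det {m s : ℕ} {h : Fin m} {r : ℕ} {A : Matrix (Fin s) (Fin s) (MP m)}
    (hA : ∀ i j, DegLE h r (A i j)) : DegLE h (s * r) A.det := by
  have := GE.det (w := negDeg h) (t := fun _ => -(r : ℝ)) hA
  unfold DegLE
  convert this using 1
  simp

lemma DegLE.D {m : ℕ} {h : Fin m} {r : ℕ} {f : MP m} (hf : DegLE h r f) (μ : Fin m →₀ ℕ) :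
    DegLE h r (D μ f) := by
  rw [degLE_iff] at hf ⊢
  intro a ha
  rw [coeff_D] at ha
  have := hf _ (left_ne_zero_of_mul ha)
  simp at this
  omega

lemma D_eq_zero {m : ℕ} {h : Fin m} {f : MP m} (hf : DegLE h 0 f) {μ : Fin m →₀ ℕ}
    (hμ : μ h ≠ 0) : D μ f = 0 := by
  ext b
  rw [coeff_D, coeff_zero]
  by_contra hne
  have := degLE_iff.mp hf _ (left_ne_zero_of_mul hne)
  simp at this
  omega

lemma pderiv_eq_zero_iff {m : ℕ} {h : Fin m} {f : MP m} : pderiv h f = 0 ↔ DegLE h 0 f := by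
  constructor
  · intro hf
    rw [degLE_iff]
    intro a ha
    have := coeff_X_mul_pderiv h f a
    rw [hf, mul_zero, coeff_zero] at this
    rcases mul_eq_zero.mp this.symm with h1 | h1
    · exact_mod_cast h1.le
    · exact absurd h1 ha
  · intro hf
    have h1 := pderiv_D h 0 f
    rw [D_zero] at h1
    rw [h1, D_eq_zero (h := h) hf (by simp), smul_zero]

lemma DegLE.T_zero {m : ℕ} {h : Fin m} {f : MP m} (hf : DegLE h 0 f) (β : Fin m → ℝ) :
    DegLE h 0 (T β f) := by
  rw [← pderiv_eq_zero_iff] at hf ⊢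
  rw [pderiv_T, hf, map_zero]

/-! ### integrality and norms -/

/-- polynomials with integer coefficients -/
noncomputable def ZP (m : ℕ) : Subring (MP m) := (MvPolynomial.map (Int.castRingHom ℝ)).range

lemma mem_ZP {m : ℕ} {f : MP m} : f ∈ ZP m ↔ ∀ a, ∃ z : ℤ, coeff a f = z := by
  constructor
  · rintro ⟨g, rfl⟩ a
    exact ⟨coeff a g, by simp [coeff_map]⟩
  · intro h
    choose z hz using h
    rw [f.as_sum]
    apply Subring.sum_mem
    intro a _
    exact ⟨monomial a (z a), by simp [map_monomial, hz]⟩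

lemma D_mem_ZP {m : ℕ} {f : MP m} (hf : f ∈ ZP m) (μ : Fin m →₀ ℕ) : D μ f ∈ ZP m := by
  rw [mem_ZP] at hf ⊢
  intro a
  obtain ⟨z, hz⟩ := hf (a + μ)
  refine ⟨z * ((∏ i, (a i + μ i).choose (μ i) : ℕ) : ℤ), ?_⟩
  rw [coeff_D, hz]
  push_cast
  rfl

lemma det_mem {R : Type*} [CommRing R] (S : Subring R) {s : ℕ} {A : Matrix (Fin s) (Fin s) R}
    (hA : ∀ i j, A i j ∈ S) : A.det ∈ S := by
  rw [Matrix.det_apply]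
  apply Subring.sum_mem
  intro σ _
  have h1 : ∏ j, A (σ j) j ∈ S := Subring.prod_mem _ (fun j _ => hA _ _)
  rcases Int.units_eq_one_or (Equiv.Perm.sign σ) with h | h
  · rw [h, one_smul]; exact h1
  · rw [h, Units.neg_smul, one_smul]; exact S.neg_mem h1

lemma L1_neg {m : ℕ} (f : MP m) : L1 (-f) = L1 f := by
  simp [L1]

lemma L1_det {m s : ℕ} {A : Matrix (Fin s) (Fin s) (MP m)} {E : ℝ}
    (hA : ∀ i j, L1 (A i j) ≤ E) : L1 A.det ≤ s.factorial * E ^ s := by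
  rw [Matrix.det_apply]
  refine (L1_sum _ _).trans ?_
  have h1 : ∀ σ : Equiv.Perm (Fin s), L1 (Equiv.Perm.sign σ • ∏ j, A (σ j) j) ≤ E ^ s := by
    intro σ
    have h1 : L1 (∏ j, A (σ j) j) ≤ E ^ s := by
      refine (L1_prod _ _).trans ?_
      refine (Finset.prod_le_prod (fun _ _ => L1_nonneg _) (fun j _ => hA (σ j) j)).trans ?_
      simp
    rcases Int.units_eq_one_or (Equiv.Perm.sign σ) with h | h
    · rw [h, one_smul]; exact h1
    · rw [h, Units.neg_smul, one_smul, L1_neg]; exact h1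
  refine (Finset.sum_le_sum (fun σ _ => h1 σ)).trans ?_
  simp [Fintype.card_perm]

lemma abs_coeff_le_L1 {m : ℕ} (f : MP m) (a : Fin m →₀ ℕ) : |coeff a f| ≤ L1 f := by
  simpa using sum_le_L1 f {a}

lemma L1_D {m : ℕ} {f : MP m} {r : Fin m → ℕ} (hf : ∀ h, DegLE h (r h) f) (μ : Fin m →₀ ℕ) :
    L1 (D μ f) ≤ 2 ^ (∑ h, r h) * L1 f := by
  classical
  have h1 : ∀ a ∈ (D μ f).support, |coeff a (D μ f)| ≤ 2 ^ (∑ h, r h) * |coeff (a + μ) f| := by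
    intro a ha
    rw [mem_support_iff, coeff_D] at ha
    have hne := left_ne_zero_of_mul ha
    rw [coeff_D, abs_mul, mul_comm]
    apply mul_le_mul_of_nonneg_right _ (abs_nonneg _)
    rw [abs_of_nonneg (by positivity), ← Finset.prod_pow_eq_pow_sum]
    apply Finset.prod_le_prod (fun _ _ => by positivity)
    intro h _
    have h2 := degLE_iff.mp (hf h) _ hne
    simp only [Finsupp.add_apply] at h2
    calc (((a h + μ h).choose (μ h) : ℕ) : ℝ) ≤ ((2 ^ (a h + μ h) : ℕ) : ℝ) := by
          exact_mod_cast Nat.choose_le_two_pow _ _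
      _ ≤ 2 ^ (r h) := by push_cast; exact pow_le_pow_right₀ (by norm_num) h2
  refine (Finset.sum_le_sum h1).trans ?_
  rw [← Finset.mul_sum]
  apply mul_le_mul_of_nonneg_left _ (by positivity)
  have := sum_le_L1 f ((D μ f).support.image (· + μ))
  rwa [Finset.sum_image (fun x _ y _ h => add_right_cancel h)] at this

/-! ### separated variables -/

lemma coeff_mul_sep {m : ℕ} {n : Fin m} {F G : MP m} (hF : DegLE n 0 F)
    (hG : ∀ h, h ≠ n → DegLE h 0 G) {a : Fin m →₀ ℕ} (ha : a n = 0) (k : ℕ) :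
    coeff (a + Finsupp.single n k) (F * G) = coeff a F * coeff (Finsupp.single n k) G := by
  classical
  rw [coeff_mul, Finset.sum_eq_single (a, Finsupp.single n k)]
  · rintro ⟨b, c⟩ hbc hne
    rw [Finset.HasAntidiagonal.mem_antidiagonal] at hbc
    simp only at hbc
    by_contra h0
    have hb := degLE_iff.mp hF b (left_ne_zero_of_mul h0)
    have hc : ∀ h, h ≠ n → c h = 0 := fun h hh => by
      have := degLE_iff.mp (hG h hh) c (right_ne_zero_of_mul h0)
      omega
    apply hne
    have e : b = a := by
      ext h
      have h1 := DFunLike.congr_fun hbc h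
      by_cases hh : h = n
      · subst hh; omega
      · simp only [Finsupp.add_apply, hc h hh, Finsupp.single_apply, if_neg (Ne.symm hh)] at h1
        simpa using h1
    subst e
    rw [add_left_cancel hbc]
  · intro h
    exfalso
    apply h
    rw [Finset.HasAntidiagonal.mem_antidiagonal]

lemma D_mul_sep {m : ℕ} {n : Fin m} {F G : MP m} (hF : DegLE n 0 F)
    (hG : ∀ h, h ≠ n → DegLE h 0 G) (μ : Fin m →₀ ℕ) (hμ : μ n = 0) (k : ℕ) :
    D (μ + Finsupp.single n k) (F * G) = D μ F * D (Finsupp.single n k) G := by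
  induction μ using multi_induction with
  | h0 =>
    rw [zero_add, D_zero]
    induction k with
    | zero => simp [D_zero]
    | succ k ih =>
      rw [Finsupp.single_add, D_succ, ih, D_succ, pderiv_mul, pderiv_eq_zero_iff.mpr hF]
      simp
  | hs μ h ih =>
    have hh : h ≠ n := by
      rintro rfl
      simp at hμ
    have hμ' : μ n = 0 := by simp at hμ; exact hμ.1
    have e : μ + Finsupp.single h 1 + Finsupp.single n k
      = μ + Finsupp.single n k + Finsupp.single h 1 := by abel
    rw [e, D_succ, ih hμ', D_succ, pderiv_mul, pderiv_eq_zero_iff.mpr ((hG h hh).D _)]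
    have e2 : (μ + Finsupp.single n k) h = μ h := by
      simp [Ne.symm hh]
    rw [e2, mul_zero, add_zero, smul_mul_assoc]

end RothAux

namespace RothAux

open MvPolynomial

lemma univ_int (v : Polynomial ℤ) (hv : v ≠ 0) (p : ℤ) (q : ℕ) (hq : 0 < q)
    (hpq : IsCoprime p (q : ℤ)) :
    ∃ k : ℕ, (q : ℤ) ^ k ∣ v.leadingCoeff ∧
      (Polynomial.taylor ((p : ℝ) / q) (v.map (Int.castRingHom ℝ))).coeff k ≠ 0 := by
  have hq0 : (q : ℚ) ≠ 0 := by positivity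
  set w := v.map (Int.castRingHom ℚ) with hw
  have hw0 : w ≠ 0 := (Polynomial.map_ne_zero_iff (RingHom.injective_int _)).mpr hv
  set β : ℚ := (p : ℚ) / q with hβ
  obtain ⟨u, hu, hnd⟩ := Polynomial.exists_eq_pow_rootMultiplicity_mul_and_not_dvd w hw0 β
  set k := w.rootMultiplicity β
  refine ⟨k, ?_, ?_⟩
  · set l : Polynomial ℤ := Polynomial.C (q : ℤ) * Polynomial.X + Polynomial.C (-p) with hl
    have hlc : l.leadingCoeff = q := Polynomial.leadingCoeff_linear (by positivity)
    have hprim : l.IsPrimitive := by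
      intro r hr
      rw [Polynomial.C_dvd_iff_dvd_coeff] at hr
      have h0 := hr 0
      have h1 := hr 1
      rw [hl, Polynomial.coeff_add, Polynomial.coeff_C_mul, Polynomial.coeff_X_one,
        Polynomial.coeff_C_succ, mul_one, add_zero] at h1
      simp [hl] at h0
      exact hpq.isUnit_of_dvd' h0 h1
    have hprimk : (l ^ k).IsPrimitive := by
      induction k with
      | zero => simpa using Polynomial.isPrimitive_one
      | succ k ih => rw [pow_succ]; exact ih.mul hprim
    have hdvd : l ^ k ∣ v := by
      rw [Polynomial.IsPrimitive.Int.dvd_iff_map_cast_dvd_map_cast _ _ hprimk, ← hw, hu]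
      have : (l ^ k).map (Int.castRingHom ℚ) = Polynomial.C ((q : ℚ) ^ k) * (Polynomial.X - Polynomial.C β) ^ k := by
        rw [Polynomial.map_pow, Polynomial.C_pow, ← mul_pow]
        congr 1
        simp only [hl, Polynomial.map_add, Polynomial.map_mul, Polynomial.map_C, Polynomial.map_X, mul_sub]
        rw [← Polynomial.C_mul, hβ, mul_div_cancel₀ _ hq0]
        simp [sub_eq_add_neg]
      rw [this]
      refine mul_dvd_mul ?_ ?_ |>.trans (dvd_of_eq (mul_comm u _)) 
      · exact (Polynomial.isUnit_C.mpr (by simp [hq0] : IsUnit ((q : ℚ) ^ k))).dvd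
      · exact dvd_rfl
    obtain ⟨y, hy⟩ := hdvd
    rw [hy, Polynomial.leadingCoeff_mul, Polynomial.leadingCoeff_pow, hlc]
    exact dvd_mul_right _ _
  · have h1 : v.map (Int.castRingHom ℝ) = w.map (algebraMap ℚ ℝ) := by
      rw [hw, Polynomial.map_map]
      congr 1
    have h2 : ((p : ℝ) / q) = algebraMap ℚ ℝ β := by simp [hβ]
    rw [h1, h2, ← Polynomial.map_taylor, Polynomial.coeff_map]
    have h3 : (Polynomial.taylor β w).coeff k ≠ 0 := by
      rw [hu, Polynomial.taylor_mul, Polynomial.taylor_pow]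
      have : Polynomial.taylor β (Polynomial.X - Polynomial.C β) = Polynomial.X := by simp
      rw [this]
      have h4 := Polynomial.coeff_X_pow_mul (Polynomial.taylor β u) k 0
      rw [zero_add] at h4
      rw [h4, Polynomial.taylor_coeff_zero]
      intro h5
      exact hnd (Polynomial.dvd_iff_isRoot.mpr h5)
    simpa using h3

lemma coeff_aeval_X {m : ℕ} (n : Fin m) (w : Polynomial ℝ) (k : ℕ) :
    coeff (Finsupp.single n k) (Polynomial.aeval (X n : MP m) w) = w.coeff k := by
  induction w using Polynomial.induction_on' with
  | add p q hp hq => simp [hp, hq]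
  | monomial j a =>
    rw [Polynomial.aeval_monomial, Polynomial.coeff_monomial, X_pow_eq_monomial,
      algebraMap_eq, C_mul_monomial, coeff_monomial]
    by_cases h : j = k
    · simp [h]
    · rw [if_neg h, if_neg]
      intro h2
      exact h (Finsupp.single_injective n h2)

lemma univ_index {m : ℕ} (n : Fin m) (V : MP m) (hV : V ≠ 0) (hVint : V ∈ ZP m)
    (hvar : ∀ h, h ≠ n → DegLE h 0 V) (β : Fin m → ℝ) (p : ℤ) (q : ℕ) (hq : 0 < q)
    (hpq : IsCoprime p (q : ℤ)) (hβ : β n = p / q) :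
    ∃ k : ℕ, (q : ℝ) ^ k ≤ L1 V ∧ coeff (Finsupp.single n k) (T β V) ≠ 0 := by
  rw [mem_ZP] at hVint
  choose z hz using hVint
  set v : Polynomial ℤ := ∑ a ∈ V.support, Polynomial.monomial (a n) (z a) with hv
  have hVv : V = Polynomial.aeval (X n : MP m) (v.map (Int.castRingHom ℝ)) := by
    conv_lhs => rw [V.as_sum]
    rw [hv, Polynomial.map_sum, map_sum]
    refine Finset.sum_congr rfl (fun a ha => ?_)
    rw [Polynomial.map_monomial, Polynomial.aeval_monomial, X_pow_eq_monomial,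
      algebraMap_eq, C_mul_monomial, mul_one]
    have : a = Finsupp.single n (a n) := by
      ext h
      by_cases hh : h = n
      · subst hh; simp
      · have := degLE_iff.mp (hvar h hh) a (mem_support_iff.mp ha)
        rw [Finsupp.single_apply, if_neg (Ne.symm hh)]
        omega
    rw [← this, hz a]
    rfl
  have hv0 : v ≠ 0 := by
    rintro h
    rw [h] at hVv
    simp at hVv
    exact hV hVv
  obtain ⟨k, hk1, hk2⟩ := univ_int v hv0 p q hq hpq
  refine ⟨k, ?_, ?_⟩
  · have h1 := Int.le_of_dvd (abs_pos.mpr (Polynomial.leadingCoeff_ne_zero.mpr hv0))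
      ((dvd_abs _ _).mpr hk1)
    have h2 : (q : ℝ) ^ k ≤ |(v.leadingCoeff : ℝ)| := by exact_mod_cast h1
    refine h2.trans ?_
    have h3 := abs_coeff_le_L1 V (Finsupp.single n v.natDegree)
    rw [hVv, coeff_aeval_X, ← hVv] at h3
    simpa using h3
  · have : T β V = Polynomial.aeval (X n : MP m) (Polynomial.taylor ((p : ℝ) / q) (v.map (Int.castRingHom ℝ))) := by
      rw [hVv, ← hβ, Polynomial.taylor_apply, Polynomial.aeval_comp, ← Polynomial.aeval_algHom_apply]
      congr 1
      simp [T]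
    rw [this, coeff_aeval_X]
    exact hk2

/-- rank decomposition -/
lemma rank_decomp {A : Type*} [CommRing A] [Algebra ℝ A] (S U : Submodule ℝ A) (N : ℕ) :
    ∀ (P : A) (f g : Fin N → A), (∀ i, f i ∈ S) → (∀ i, g i ∈ U) → P = ∑ i, f i * g i →
    ∃ s ≤ N, ∃ (f g : Fin s → A), (∀ i, f i ∈ S) ∧ (∀ i, g i ∈ U) ∧ P = ∑ i, f i * g i ∧
      LinearIndependent ℝ f ∧ LinearIndependent ℝ g := by
  induction N with
  | zero =>
    intro P f g hf hg hP
    exact ⟨0, le_rfl, f, g, hf, hg, hP, linearIndependent_empty_type, linearIndependent_empty_type⟩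
  | succ N ih =>
    intro P f g hf hg hP
    -- generic reduction
    have red : ∀ (f g : Fin (N + 1) → A), P = ∑ i, f i * g i → ¬ LinearIndependent ℝ f →
        ∃ (l : Fin (N + 1)) (c : Fin (N + 1) → ℝ),
          P = ∑ j : Fin N, f (l.succAbove j) * (g (l.succAbove j) + c (l.succAbove j) • g l) := by
      intro f g hP hli
      rw [Fintype.not_linearIndependent_iff] at hli
      obtain ⟨c, hc, l, hl⟩ := hli
      refine ⟨l, fun j => -(c j / c l), ?_⟩
      have h1 : f l = ∑ j : Fin N, (-(c (l.succAbove j) / c l)) • f (l.succAbove j) := by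
        rw [Fin.sum_univ_succAbove _ l] at hc
        have h2 : c l • f l = - ∑ j : Fin N, c (l.succAbove j) • f (l.succAbove j) :=
          eq_neg_of_add_eq_zero_left hc
        have h3 : f l = (c l)⁻¹ • (c l • f l) := by rw [smul_smul, inv_mul_cancel₀ hl, one_smul]
        rw [h3, h2, smul_neg, Finset.smul_sum, ← Finset.sum_neg_distrib]
        refine Finset.sum_congr rfl (fun j _ => ?_)
        rw [smul_smul, neg_smul, div_eq_inv_mul]
      rw [hP, Fin.sum_univ_succAbove _ l]
      simp only [mul_add, Finset.sum_add_distrib]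
      rw [add_comm]
      congr 1
      conv_lhs => rw [h1]
      rw [Finset.sum_mul]
      refine Finset.sum_congr rfl (fun j _ => ?_)
      rw [smul_mul_assoc, mul_smul_comm]
    by_cases hlf : LinearIndependent ℝ f
    · by_cases hlg : LinearIndependent ℝ g
      · exact ⟨N + 1, le_rfl, f, g, hf, hg, hP, hlf, hlg⟩
      · obtain ⟨l, c, hP'⟩ := red g f (by rw [hP]; exact Finset.sum_congr rfl (fun _ _ => mul_comm _ _)) hlg
        obtain ⟨s, hs, r⟩ := ih P (fun j => f (l.succAbove j) + c (l.succAbove j) • f l)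
          (fun j => g (l.succAbove j))
          (fun i => S.add_mem (hf _) (S.smul_mem _ (hf _))) (fun i => hg _)
          (by rw [hP']; exact Finset.sum_congr rfl (fun _ _ => mul_comm _ _))
        exact ⟨s, by omega, r⟩
    · obtain ⟨l, c, hP'⟩ := red f g hP hlf
      obtain ⟨s, hs, r⟩ := ih P (fun j => f (l.succAbove j))
          (fun j => g (l.succAbove j) + c (l.succAbove j) • g l)
          (fun i => hf _) (fun i => U.add_mem (hg _) (U.smul_mem _ (hg _))) hP'
      exact ⟨s, by omega, r⟩

/-- polynomials of bounded partial degrees -/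
def degSub {m : ℕ} (r : Fin m → ℕ) (H : Set (Fin m)) : Submodule ℝ (MP m) where
  carrier := {f | ∀ h ∈ H, DegLE h (r h) f}
  add_mem' hf hg := fun h hh => (hf h hh).add (hg h hh)
  zero_mem' := fun _ _ => GE.zero
  smul_mem' c _ hf := fun h hh => (hf h hh).smul c

lemma DegLE_monomial {m : ℕ} {h : Fin m} {r : ℕ} {a : Fin m →₀ ℕ} (c : ℝ) (ha : a h ≤ r) :
    DegLE h r (monomial a c) := by
  classical
  rw [degLE_iff]
  intro b hb
  rw [coeff_monomial] at hb
  split_ifs at hb with h1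
  · rwa [← h1]
  · exact absurd rfl hb

lemma decomp {m : ℕ} (n : Fin m) (r : Fin m → ℕ) (P : MP m) (hP : ∀ h, DegLE h (r h) P) :
    ∃ s ≤ r n + 1, ∃ (f g : Fin s → MP m), (∀ i h, DegLE h (r h) (f i)) ∧
      (∀ i, DegLE n 0 (f i)) ∧ (∀ i h, h ≠ n → DegLE h 0 (g i)) ∧ P = ∑ i, f i * g i ∧
      LinearIndependent ℝ f ∧ LinearIndependent ℝ g := by
  classical
  obtain ⟨s, hs, f, g, hf, hg, h1, h2, h3⟩ := rank_decomp
    (degSub (Function.update r n 0) Set.univ) (degSub (m := m) (fun _ => 0) {n}ᶜ) (r n + 1) P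
    (fun k => ∑ a ∈ P.support with a n = k.1, monomial (a.erase n) (coeff a P))
    (fun k => X n ^ k.1) (by
      intro k
      apply Submodule.sum_mem
      intro a ha h _
      rw [Finset.mem_filter] at ha
      apply DegLE_monomial
      by_cases hh : h = n
      · subst hh; simp
      · rw [Function.update_of_ne hh, Finsupp.erase_ne hh]
        exact degLE_iff.mp (hP h) a (mem_support_iff.mp ha.1))
    (by
      intro k h hh
      rw [X_pow_eq_monomial]
      apply DegLE_monomial
      have : h ≠ n := hh
      simp [this]) (by
      conv_lhs => rw [P.as_sum]
      simp only [Finset.sum_mul]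
      rw [Finset.sum_fin_eq_sum_range (n := r n + 1) (c := fun k => ∑ a ∈ P.support with a n = k.1, monomial (a.erase n) (coeff a P) * X n ^ k.1)]
      rw [← Finset.sum_fiberwise_of_maps_to (s := P.support) (t := Finset.range (r n + 1)) (g := fun a => a n)]
      · refine Finset.sum_congr rfl (fun k hk => ?_)
        rw [dif_pos (Finset.mem_range.mp hk)]
        refine Finset.sum_congr rfl (fun a ha => ?_)
        rw [Finset.mem_filter] at ha
        rw [X_pow_eq_monomial, monomial_mul, mul_one, ← ha.2, Finsupp.erase_add_single]
      · intro a ha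
        have := degLE_iff.mp (hP n) a (mem_support_iff.mp ha)
        simp; omega)
  refine ⟨s, hs, f, g, ?_, ?_, ?_, h1, h2, h3⟩
  · intro i h
    have := hf i h (Set.mem_univ h)
    rw [degLE_iff] at this ⊢
    intro a ha
    refine (this a ha).trans ?_
    by_cases hh : h = n
    · subst hh; simp
    · rw [Function.update_of_ne hh]
  · intro i
    have := hf i n (Set.mem_univ n)
    rwa [Function.update_self] at this
  · intro i h hh
    exact hg i h hh

end RothAux

namespace RothAux

open MvPolynomial

/-- index weight -/
noncomputable def wt {m : ℕ} (r : Fin m → ℕ) : (Fin m →₀ ℕ) →+ ℝ where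
  toFun a := ∑ h, (a h : ℝ) / r h
  map_zero' := by simp
  map_add' a b := by simp [add_div, Finset.sum_add_distrib]

lemma wt_apply {m : ℕ} (r : Fin m → ℕ) (a : Fin m →₀ ℕ) : wt r a = ∑ h, (a h : ℝ) / r h := rfl

lemma wt_nonneg {m : ℕ} (r : Fin m → ℕ) (a : Fin m →₀ ℕ) : 0 ≤ wt r a := by
  rw [wt_apply]; positivity

lemma wt_single {m : ℕ} (r : Fin m → ℕ) (n : Fin m) (k : ℕ) :
    wt r (Finsupp.single n k) = (k : ℝ) / r n := by
  classical
  rw [wt_apply, Finset.sum_eq_single n]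
  · simp
  · intro b _ hb; simp [hb]
  · simp

lemma T_ne_zero {m : ℕ} (β : Fin m → ℝ) {f : MP m} (hf : f ≠ 0) : T β f ≠ 0 := by
  have h1 : ∀ g : MP m, T (fun i => -β i) (T β g) = g := by
    intro g
    have : (T (fun i => -β i)).comp (T β) = AlgHom.id ℝ (MP m) := by
      ext i
      simp [T]
    exact congrArg (fun φ => φ g) this
  intro h
  apply hf
  rw [← h1 f, h, map_zero]

lemma single_of_degLE {m : ℕ} {n : Fin m} {G : MP m} (hG : ∀ h, h ≠ n → DegLE h 0 G)
    {b : Fin m →₀ ℕ} (hb : coeff b G ≠ 0) : b = Finsupp.single n (b n) := by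
  ext h
  by_cases hh : h = n
  · subst hh; simp
  · have := degLE_iff.mp (hG h hh) b hb
    rw [Finsupp.single_apply, if_neg (Ne.symm hh)]
    omega

lemma sep_left {m : ℕ} {n : Fin m} {F G : MP m} (hF : DegLE n 0 F)
    (hG : ∀ h, h ≠ n → DegLE h 0 G) (hZ : F * G ∈ ZP m) (k : ℕ) :
    C (coeff (Finsupp.single n k) G) * F ∈ ZP m ∧
    L1 (C (coeff (Finsupp.single n k) G) * F) ≤ L1 (F * G) := by
  classical
  have key : ∀ a, coeff a F ≠ 0 → coeff a (C (coeff (Finsupp.single n k) G) * F) =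
      coeff (a + Finsupp.single n k) (F * G) := by
    intro a ha
    have h0 : a n = 0 := by have := degLE_iff.mp hF a ha; omega
    rw [coeff_C_mul, coeff_mul_sep hF hG h0, mul_comm]
  constructor
  · rw [mem_ZP] at hZ ⊢
    intro a
    by_cases ha : coeff a F = 0
    · exact ⟨0, by simp [coeff_C_mul, ha]⟩
    · rw [key a ha]; exact hZ _
  · have h1 : ∀ a ∈ (C (coeff (Finsupp.single n k) G) * F).support, coeff a F ≠ 0 := by
      intro a ha
      rw [mem_support_iff, coeff_C_mul] at ha
      exact right_ne_zero_of_mul ha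
    rw [L1, Finset.sum_congr rfl (fun a ha => by rw [key a (h1 a ha)])]
    have := sum_le_L1 (F * G) ((C (coeff (Finsupp.single n k) G) * F).support.image
      (· + Finsupp.single n k))
    rwa [Finset.sum_image (fun x _ y _ h => add_right_cancel h)] at this

lemma sep_right {m : ℕ} {n : Fin m} {F G : MP m} (hF : DegLE n 0 F)
    (hG : ∀ h, h ≠ n → DegLE h 0 G) (hZ : F * G ∈ ZP m) (a : Fin m →₀ ℕ) (ha : a n = 0) :
    C (coeff a F) * G ∈ ZP m ∧ L1 (C (coeff a F) * G) ≤ L1 (F * G) := by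
  classical
  have key : ∀ b, coeff b G ≠ 0 → coeff b (C (coeff a F) * G) = coeff (a + b) (F * G) := by
    intro b hb
    rw [single_of_degLE hG hb, coeff_C_mul, coeff_mul_sep hF hG ha]
  constructor
  · rw [mem_ZP] at hZ ⊢
    intro b
    by_cases hb : coeff b G = 0
    · exact ⟨0, by simp [coeff_C_mul, hb]⟩
    · rw [key b hb]; exact hZ _
  · have h1 : ∀ b ∈ (C (coeff a F) * G).support, coeff b G ≠ 0 := by
      intro b hb
      rw [mem_support_iff, coeff_C_mul] at hb
      exact right_ne_zero_of_mul hb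
    rw [L1, Finset.sum_congr rfl (fun b hb => by rw [key b (h1 b hb)])]
    have := sum_le_L1 (F * G) ((C (coeff a F) * G).support.image (a + ·))
    rwa [Finset.sum_image (fun x _ y _ h => add_left_cancel h)] at this

lemma count_bound (x : ℝ) (hx : 0 < x) (hx1 : x ≤ 1) (r s : ℕ) (hr : 0 < r) (hs : s ≤ r + 1) :
    s * (x ^ 2 / 8) ≤ ∑ j : Fin s, max 0 (x - (j : ℕ) / (r : ℝ)) := by
  have hr' : (0 : ℝ) < r := by exact_mod_cast hr
  rw [Fin.sum_univ_eq_sum_range (fun j => max 0 (x - (j : ℝ) / (r : ℝ))) s]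
  set N := min s ⌈x * r / 2⌉₊ with hN
  have hsub : Finset.range N ⊆ Finset.range s := Finset.range_subset_range.mpr (min_le_left _ _)
  refine le_trans ?_ (Finset.sum_le_sum_of_subset_of_nonneg hsub (fun _ _ _ => le_max_left _ _))
  have h1 : ∀ j ∈ Finset.range N, x / 2 ≤ max 0 (x - (j : ℝ) / (r : ℝ)) := by
    intro j hj
    rw [Finset.mem_range, hN, lt_min_iff, Nat.lt_ceil] at hj
    refine le_trans ?_ (le_max_right _ _)
    have : (j : ℝ) / r ≤ x / 2 := by
      rw [div_le_iff₀ hr']; linarith [hj.2]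
    linarith
  have h2 := Finset.card_nsmul_le_sum _ _ _ h1
  rw [Finset.card_range, nsmul_eq_mul] at h2
  refine le_trans ?_ h2
  have hs2 : (s : ℝ) ≤ 2 * r := by
    have : s ≤ 2 * r := by omega
    exact_mod_cast this
  have h3 : (s : ℝ) * (x / 4) ≤ N := by
    rw [hN, Nat.cast_min, le_min_iff]
    constructor
    · nlinarith [(Nat.cast_nonneg s : (0 : ℝ) ≤ s)]
    · refine le_trans ?_ (Nat.le_ceil _)
      nlinarith
  nlinarith

lemma one_le_L1 {m : ℕ} {f : MP m} (hf : f ≠ 0) (hz : f ∈ ZP m) : 1 ≤ L1 f := by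
  obtain ⟨a, ha⟩ := ne_zero_iff.mp hf
  obtain ⟨z, hz⟩ := mem_ZP.mp hz a
  refine le_trans ?_ (abs_coeff_le_L1 f a)
  rw [hz] at ha ⊢
  have : z ≠ 0 := by exact_mod_cast ha
  exact_mod_cast Int.one_le_abs this

end RothAux

namespace RothAux

open MvPolynomial

lemma wdecomp {m : ℕ} (n : Fin m) (r : Fin m → ℕ) (P : MP m) (hP : ∀ h, DegLE h (r h) P)
    (hP0 : P ≠ 0) :
    ∃ s, 0 < s ∧ s ≤ r n + 1 ∧ ∃ (μ : Fin s → Fin m →₀ ℕ) (k : Fin s → ℕ) (U V : MP m),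
      (∀ i, (μ i).degree < s) ∧ (∀ i h, (r h = 0 ∨ h = n) → μ i h = 0) ∧
      Function.Injective k ∧ (∀ i, k i < s) ∧ U ≠ 0 ∧ V ≠ 0 ∧ DegLE n 0 U ∧
      (∀ h, DegLE h (s * r h) U) ∧ (∀ h, h ≠ n → DegLE h 0 V) ∧
      U * V = (Matrix.of fun i l => D (μ i + Finsupp.single n (k l)) P).det := by
  classical
  obtain ⟨s, hs, f, g, hf, hfn, hg, hsum, hfi, hgi⟩ := decomp n r P hP
  have hs0 : 0 < s := by
    rcases Nat.eq_zero_or_pos s with h | h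
    · subst h; simp at hsum; exact absurd hsum hP0
    · exact h
  obtain ⟨μ, hμd, hU⟩ := wronskian f hfi
  obtain ⟨ν, hνd, hV⟩ := wronskian g hgi
  have hμ0 : ∀ i h, (r h = 0 ∨ h = n) → μ i h = 0 := by
    intro i h hh
    by_contra hne
    apply hU
    apply Matrix.det_eq_zero_of_row_eq_zero i
    intro j
    rw [Matrix.of_apply]
    refine D_eq_zero ?_ hne
    rcases hh with hh | hh
    · have := hf j h; rwa [hh] at this
    · rw [hh]; exact hfn j
  have hν0 : ∀ i h, h ≠ n → ν i h = 0 := by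
    intro i h hh
    by_contra hne
    apply hV
    apply Matrix.det_eq_zero_of_row_eq_zero i
    intro j
    rw [Matrix.of_apply]
    exact D_eq_zero (hg j h hh) hne
  have hνs : ∀ i, ν i = Finsupp.single n (ν i n) := by
    intro i
    ext h
    by_cases hh : h = n
    · subst hh; simp
    · rw [hν0 i h hh, Finsupp.single_apply, if_neg (Ne.symm hh)]
  refine ⟨s, hs0, hs, μ, fun i => ν i n, _, _, hμd, hμ0, ?_, ?_, hU, hV, ?_, ?_, ?_, ?_⟩
  · intro i j hij
    by_contra hne
    apply hV
    refine Matrix.det_zero_of_row_eq hne ?_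
    ext l
    have : ν i = ν j := by rw [hνs i, hνs j]; simp only at hij; rw [hij]
    simp [this]
  · intro i
    refine lt_of_le_of_lt ?_ (hνd i)
    exact Finsupp.le_degree n (ν i)
  · have := DegLE.det (h := n) (r := 0) (A := Matrix.of fun i j => D (μ i) (f j))
      (fun i j => by rw [Matrix.of_apply]; exact (hfn j).D _)
    simpa using this
  · intro h
    exact DegLE.det (fun i j => by rw [Matrix.of_apply]; exact (hf j h).D _)
  · intro h hh
    have := DegLE.det (h := h) (r := 0) (A := Matrix.of fun i j => D (ν i) (g j))
      (fun i j => by rw [Matrix.of_apply]; exact (hg j h hh).D _)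
    simpa using this
  · rw [← Matrix.det_transpose (Matrix.of fun i j => D (ν i) (g j)), ← Matrix.det_mul]
    congr 1
    ext1 i l
    simp only [Matrix.mul_apply, Matrix.of_apply, Matrix.transpose_apply]
    conv_rhs => rw [hsum, map_sum]
    refine Finset.sum_congr rfl fun j _ => ?_
    rw [D_mul_sep (hfn j) (hg j) (μ i) (hμ0 i n (Or.inr rfl)), ← hνs l]

lemma GE_D {m : ℕ} {r : Fin m → ℕ} {t : ℝ} {f : MP m} (hf : GE (wt r) t f) (μ : Fin m →₀ ℕ) :
    GE (wt r) (max 0 (t - wt r μ)) (D μ f) := by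
  intro b hb
  rw [coeff_D] at hb
  have := hf _ (left_ne_zero_of_mul hb)
  rw [map_add] at this
  exact max_le (wt_nonneg _ _) (by linarith)

lemma lower_wt {m : ℕ} (n : Fin m) (r : Fin m → ℕ) (hrn : 0 < r n) (P : MP m) (β : Fin m → ℝ)
    (x : ℝ) (hx : 0 < x) (hx1 : x ≤ 1) (hGE : GE (wt r) (2 * x) (T β P))
    (s : ℕ) (hs : s ≤ r n + 1) (μ : Fin s → Fin m →₀ ℕ) (k : Fin s → ℕ)
    (hk : Function.Injective k) (hks : ∀ i, k i < s) (hμ : ∀ i, wt r (μ i) ≤ x) :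
    GE (wt r) (s * (x ^ 2 / 8))
      (T β (Matrix.of fun i l => D (μ i + Finsupp.single n (k l)) P).det) := by
  have h1 : GE (wt r) (∑ l : Fin s, max 0 (x - (k l : ℝ) / (r n : ℝ)))
      (T β (Matrix.of fun i l => D (μ i + Finsupp.single n (k l)) P).det) := by
    rw [AlgHom.map_det]
    apply GE.det
    intro i l b hb
    simp only [AlgHom.mapMatrix_apply, Matrix.map_apply, Matrix.of_apply] at hb
    rw [← D_T] at hb
    refine le_trans ?_ (GE_D hGE _ b hb)
    rw [map_add, wt_single]
    have := hμ i
    apply max_le_max le_rfl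
    linarith
  have h2 : ∑ l : Fin s, max 0 (x - (k l : ℝ) / (r n : ℝ)) =
      ∑ j : Fin s, max 0 (x - ((j : ℕ) : ℝ) / (r n : ℝ)) := by
    have hinj : Function.Injective (fun l : Fin s => (⟨k l, hks l⟩ : Fin s)) := by
      intro a b hab
      simp at hab
      exact hk hab
    exact (Finite.injective_iff_bijective.mp hinj).sum_comp
      (fun j : Fin s => max 0 (x - ((j : ℕ) : ℝ) / (r n : ℝ)))
  intro b hb
  exact (count_bound x hx hx1 (r n) s hrn hs).trans (h2 ▸ h1 b hb)

lemma log_det_bound {m s : ℕ} (n : Fin m) (r : Fin m → ℕ) (P : MP m) (hP : ∀ h, DegLE h (r h) P)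
    (hs0 : 0 < s) (hs : s ≤ r n + 1) (μ : Fin s → Fin s → Fin m →₀ ℕ)
    (hL : 1 ≤ L1 P) (Y : ℝ) (hY : 0 ≤ Y) (hr : ∀ h, (r h : ℝ) ≤ Y) (hlog : Real.log (L1 P) ≤ Y) :
    L1 (Matrix.of fun i l => D (μ i l) P).det ≤ Real.exp (s * ((m + 2) * Y)) := by
  have h1 := L1_det (A := Matrix.of fun i l => D (μ i l) P) (E := 2 ^ (∑ h, r h) * L1 P)
    (fun i l => by rw [Matrix.of_apply]; exact L1_D hP _)
  refine h1.trans ?_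
  have h2 : (s.factorial : ℝ) ≤ (s : ℝ) ^ s := by exact_mod_cast Nat.factorial_le_pow s
  have h3 : (s : ℝ) ≤ Real.exp Y := by
    have : (s : ℝ) ≤ r n + 1 := by exact_mod_cast hs
    linarith [hr n, Real.add_one_le_exp Y]
  have h4 : L1 P ≤ Real.exp Y := by
    rwa [Real.log_le_iff_le_exp (by linarith)] at hlog
  have h5 : (2 : ℝ) ^ (∑ h, r h) ≤ Real.exp (m * Y) := by
    have h2e : (2 : ℝ) ≤ Real.exp 1 := by linarith [Real.add_one_le_exp 1]
    calc (2 : ℝ) ^ (∑ h, r h) ≤ Real.exp 1 ^ (∑ h, r h) := by gcongr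
      _ = Real.exp ((∑ h, r h : ℕ) : ℝ) := by rw [← Real.exp_nat_mul]; simp
      _ ≤ _ := by
        apply Real.exp_le_exp.mpr
        push_cast
        calc ∑ h, (r h : ℝ) ≤ ∑ h : Fin m, Y := Finset.sum_le_sum fun h _ => hr h
          _ = m * Y := by simp
  calc (s.factorial : ℝ) * (2 ^ (∑ h, r h) * L1 P) ^ s
      ≤ (s : ℝ) ^ s * (2 ^ (∑ h, r h) * L1 P) ^ s := by gcongr
    _ = (s * (2 ^ (∑ h, r h) * L1 P)) ^ s := by rw [mul_pow (s : ℝ)]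
    _ ≤ (Real.exp Y * (Real.exp (m * Y) * Real.exp Y)) ^ s := by gcongr
    _ = Real.exp (s * ((m + 2) * Y)) := by
      rw [← Real.exp_add, ← Real.exp_add, ← Real.exp_nat_mul]; ring_nf

def RothLemmaFor {m : ℕ} (S : Finset (Fin m)) (η δ : ℝ) : Prop :=
  ∀ (r : Fin m → ℕ) (p : Fin m → ℤ) (q : Fin m → ℕ) (P : MP m) (M : ℝ),
    (∀ h ∈ S, 0 < r h) → (∀ h, h ∉ S → r h = 0) →
    (∀ h ∈ S, ∀ k ∈ S, h < k → (r k : ℝ) ≤ δ * r h) →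
    (∀ h, 0 < q h) → (∀ h, IsCoprime (p h) (q h : ℤ)) → P ≠ 0 → P ∈ ZP m →
    (∀ h, DegLE h (r h) P) → (∀ h ∈ S, M ≤ r h * Real.log (q h)) →
    (∀ h ∈ S, (r h : ℝ) ≤ δ * M) → Real.log (L1 P) ≤ δ * M →
    ∃ a, wt r a ≤ η ∧ coeff a (T (fun h => (p h : ℝ) / q h) P) ≠ 0

lemma roth_step {m : ℕ} (n : Fin m) (S : Finset (Fin m)) (hn : ∀ h ∈ S, h < n)
    (ih : ∀ η > 0, ∃ δ > 0, RothLemmaFor S η δ) (η : ℝ) (hη : 0 < η) :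
    ∃ δ > 0, RothLemmaFor (insert n S) η δ := by
  classical
  have hnS : n ∉ S := fun h => lt_irrefl _ (hn n h)
  set η₀ := min η 1 with hη₀
  have hη₀0 : 0 < η₀ := by rw [hη₀]; positivity
  have hη₀1 : η₀ ≤ 1 := min_le_right _ _
  obtain ⟨δ', hδ', ih⟩ := ih (η₀ ^ 2 / 128) (by positivity)
  set c : ℝ := m + 2 with hc
  have hc1 : 1 ≤ c := by rw [hc]; linarith [(Nat.cast_nonneg m : (0 : ℝ) ≤ m)]
  set δ := min (δ' / c) (min (η₀ ^ 2 / (128 * c)) (η₀ / 2)) with hδ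
  have hδ0 : 0 < δ := by rw [hδ]; positivity
  have hδ1 : c * δ ≤ δ' := by
    have : δ ≤ δ' / c := min_le_left _ _
    rw [le_div_iff₀ (by positivity)] at this; linarith
  have hδ2 : c * δ ≤ η₀ ^ 2 / 128 := by
    have : δ ≤ η₀ ^ 2 / (128 * c) := (min_le_right _ _).trans (min_le_left _ _)
    rw [le_div_iff₀ (by positivity)] at this; linarith
  have hδ3 : δ ≤ η₀ / 2 := (min_le_right _ _).trans (min_le_right _ _)
  have hδδ' : δ ≤ δ' := by nlinarith
  refine ⟨δ, hδ0, ?_⟩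
  intro r p q P M hr hr0 hrat hq hpq hP0 hPZ hPd hM hrM hlog
  set β : Fin m → ℝ := fun h => (p h : ℝ) / q h with hβ
  have hrn : 0 < r n := hr n (Finset.mem_insert_self _ _)
  have hrn' : (0 : ℝ) < r n := by exact_mod_cast hrn
  have hM0 : 0 < M := by
    have := hrM n (Finset.mem_insert_self _ _)
    by_contra hcon
    nlinarith
  have hMn := hM n (Finset.mem_insert_self _ _)
  have hqn : 0 < Real.log (q n) := by
    by_contra hcon
    nlinarith
  by_contra hcon
  push Not at hcon
  have hGE : GE (wt r) (2 * (η₀ / 2)) (T β P) := by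
    intro a ha
    by_contra hlt
    refine ha (hcon a ?_)
    have : η₀ ≤ η := min_le_left _ _
    linarith
  obtain ⟨s, hs0, hs, μ, k, U, V, hμd, hμ0, hk, hks, hU, hV, hUn, hUd, hVd, hUV⟩ :=
    wdecomp n r P hPd hP0
  have hs0' : (0 : ℝ) < s := by exact_mod_cast hs0
  have hwμ : ∀ i, wt r (μ i) ≤ η₀ / 2 := by
    intro i
    refine le_trans ?_ hδ3
    have h1 : ∀ h, (μ i h : ℝ) / r h ≤ (μ i h : ℝ) * (δ / r n) := by
      intro h
      by_cases hh : h ∈ S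
      · have h2 := hrat h (Finset.mem_insert_of_mem hh) n (Finset.mem_insert_self _ _) (hn h hh)
        have h3 : (0 : ℝ) < r h := by exact_mod_cast hr h (Finset.mem_insert_of_mem hh)
        rw [div_eq_mul_inv]
        gcongr
        rw [inv_eq_one_div, div_le_div_iff₀ h3 hrn']
        linarith
      · have : μ i h = 0 := by
          apply hμ0
          by_cases h4 : h = n
          · exact Or.inr h4
          · exact Or.inl (hr0 h (by simp [h4, hh]))
        simp [this]
    have h5 : ((μ i).degree : ℝ) ≤ r n := by
      have : (μ i).degree ≤ r n := by have := hμd i; omega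
      exact_mod_cast this
    calc wt r (μ i) ≤ ∑ h, (μ i h : ℝ) * (δ / r n) := by
          rw [wt_apply]; exact Finset.sum_le_sum fun h _ => h1 h
      _ = ((μ i).degree : ℝ) * (δ / r n) := by
          rw [← Finset.sum_mul, Finsupp.degree_eq_sum]; push_cast; rfl
      _ ≤ r n * (δ / r n) := by gcongr
      _ = δ := by field_simp
  have hlow := lower_wt n r hrn P β (η₀ / 2) (by positivity) (by linarith) hGE s hs μ k hk hks hwμ
  have hL1W := log_det_bound n r P hPd hs0 hs (fun i l => μ i + Finsupp.single n (k l))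
    (one_le_L1 hP0 hPZ) (δ * M) (by positivity)
    (fun h => by
      by_cases hh : h ∈ insert n S
      · exact hrM h hh
      · rw [hr0 h hh]; simp; positivity) hlog
  have hWZ : (Matrix.of fun i l => D (μ i + Finsupp.single n (k l)) P).det ∈ ZP m :=
    det_mem _ (fun i l => by rw [Matrix.of_apply]; exact D_mem_ZP hPZ _)
  rw [← hUV] at hL1W hWZ hlow
  -- the factor U
  obtain ⟨b, hb⟩ := ne_zero_iff.mp hV
  rw [single_of_degLE hVd hb] at hb
  obtain ⟨hU'Z, hU'L⟩ := sep_left hUn hVd hWZ (b n)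
  set v := coeff (Finsupp.single n (b n)) V with hv
  obtain ⟨a₀, ha₀⟩ := ne_zero_iff.mp hU
  have ha₀n : a₀ n = 0 := by have := degLE_iff.mp hUn a₀ ha₀; omega
  obtain ⟨hV'Z, hV'L⟩ := sep_right hUn hVd hWZ a₀ ha₀n
  set u := coeff a₀ U with hu
  have hCU : ∀ (h : Fin m) (t : ℕ) (x : ℝ) (F : MP m), DegLE h t F → DegLE h t (C x * F) := by
    intro h t x F hF
    rw [← smul_eq_C_mul]
    exact GE.smul x hF
  have hU'0 : C v * U ≠ 0 := mul_ne_zero (by simpa using hb) hU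
  have hV'0 : C u * V ≠ 0 := mul_ne_zero (by simpa using ha₀) hV
  obtain ⟨a', ha'w, ha'c⟩ := ih (fun h => if h ∈ S then s * r h else 0) p q (C v * U) (s * M)
    (fun h hh => by
      simp only [hh, if_true]
      exact Nat.mul_pos hs0 (hr h (Finset.mem_insert_of_mem hh)))
    (fun h hh => by simp [hh])
    (fun h hh l hl hhl => by
      simp only [hh, hl, if_true]
      have := hrat h (Finset.mem_insert_of_mem hh) l (Finset.mem_insert_of_mem hl) hhl
      push_cast
      have h3 : (0 : ℝ) ≤ r h := Nat.cast_nonneg _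
      calc (s : ℝ) * r l ≤ s * (δ * r h) := by gcongr
        _ ≤ s * (δ' * r h) := by gcongr
        _ = _ := by ring)
    hq hpq hU'0 hU'Z
    (fun h => by
      by_cases hh : h ∈ S
      · simp only [hh, if_true]; exact hCU _ _ _ _ (hUd h)
      · simp only [hh, if_false]
        by_cases h4 : h = n
        · rw [h4]; exact hCU _ _ _ _ hUn
        · have := hUd h
          rw [hr0 h (by simp [h4, hh]), mul_zero] at this
          exact hCU _ _ _ _ this)
    (fun h hh => by
      simp only [hh, if_true]
      have := hM h (Finset.mem_insert_of_mem hh)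
      push_cast
      rw [mul_assoc]
      gcongr)
    (fun h hh => by
      simp only [hh, if_true]
      have := hrM h (Finset.mem_insert_of_mem hh)
      push_cast
      calc (s : ℝ) * r h ≤ s * (δ * M) := by gcongr
        _ ≤ s * (δ' * M) := by gcongr
        _ = _ := by ring)
    (by
      have h1 := hU'L.trans hL1W
      have h2 := one_le_L1 hU'0 hU'Z
      rw [← Real.log_le_iff_le_exp (by linarith)] at h1
      refine h1.trans ?_
      calc (s : ℝ) * (c * (δ * M)) = s * M * (c * δ) := by ring
        _ ≤ s * M * δ' := by gcongr
        _ = _ := by ring)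
  obtain ⟨κ, hκ, hκc⟩ := univ_index n (C u * V) hV'0 hV'Z (fun h hh => hCU _ _ _ _ (hVd h hh)) β
    (p n) (q n) (hq n) (hpq n) rfl
  have hTC : ∀ (x : ℝ) (F : MP m), T β (C x * F) = C x * T β F := by
    intro x F
    rw [← smul_eq_C_mul, map_smul, smul_eq_C_mul]
  change coeff a' (T β (C v * U)) ≠ 0 at ha'c
  rw [hTC, coeff_C_mul] at ha'c hκc
  have hca := right_ne_zero_of_mul ha'c
  have hcκ := right_ne_zero_of_mul hκc
  have ha'n : a' n = 0 := by
    have := degLE_iff.mp (hUn.T_zero β) a' hca; omega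
  have hfin := hlow (a' + Finsupp.single n κ) (by
    rw [map_mul, coeff_mul_sep (hUn.T_zero β) (fun h hh => (hVd h hh).T_zero β) ha'n]
    exact mul_ne_zero hca hcκ)
  rw [map_add, wt_single] at hfin
  have hκ2 : (κ : ℝ) / r n ≤ s * (c * δ) := by
    rw [div_le_iff₀ hrn']
    have h1 := hκ.trans (hV'L.trans hL1W)
    rw [← Real.log_le_iff_le_exp (by have := hq n; positivity), Real.log_pow] at h1
    have h2 : (κ : ℝ) * Real.log (q n) ≤ (s * (c * δ) * r n) * Real.log (q n) := by
      calc (κ : ℝ) * Real.log (q n) ≤ s * (c * (δ * M)) := h1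
        _ ≤ s * (c * (δ * (r n * Real.log (q n)))) := by gcongr
        _ = _ := by ring
    exact le_of_mul_le_mul_right h2 hqn
  have hwa : wt r a' ≤ s * (η₀ ^ 2 / 128) := by
    have : wt r a' = s * wt (fun h => if h ∈ S then s * r h else 0) a' := by
      rw [wt_apply, wt_apply, Finset.mul_sum]
      refine Finset.sum_congr rfl fun h _ => ?_
      by_cases hh : h ∈ S
      · simp only [hh, if_true]
        have h3 : (0 : ℝ) < r h := by exact_mod_cast hr h (Finset.mem_insert_of_mem hh)
        push_cast
        field_simp
      · have : a' h = 0 := by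
          by_cases h4 : h = n
          · rw [h4]; exact ha'n
          · have h5 := hUd h
            rw [hr0 h (by simp [h4, hh]), mul_zero] at h5
            have := degLE_iff.mp (h5.T_zero β) a' hca
            omega
        simp [this]
    rw [this]
    gcongr
  have h9 : (s : ℝ) * (c * δ) ≤ s * (η₀ ^ 2 / 128) := by gcongr
  have h10 : 0 < s * η₀ ^ 2 := by positivity
  nlinarith

lemma roth_lemma {m : ℕ} (η : ℝ) (hη : 0 < η) :
    ∃ δ > 0, RothLemmaFor (Finset.univ : Finset (Fin m)) η δ := by
  have key : ∀ S : Finset (Fin m), ∀ η > 0, ∃ δ > 0, RothLemmaFor S η δ := by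
    intro S
    induction S using Finset.induction_on_max with
    | empty =>
      intro η hη
      refine ⟨1, one_pos, ?_⟩
      intro r p q P M hr hr0 hrat hq hpq hP0 hPZ hPd hM hrM hlog
      obtain ⟨a, ha⟩ := ne_zero_iff.mp (T_ne_zero (fun h => (p h : ℝ) / q h) hP0)
      refine ⟨a, ?_, ha⟩
      rw [wt_apply]
      simp only [fun h => hr0 h (Finset.notMem_empty h)]
      simp
      exact hη.le
    | insert n S hn ih =>
      intro η hη
      exact roth_step n S hn ih η hη
  exact key _ η hη

end RothAux

namespace RothAux

open MvPolynomial

lemma alg_powers (α : ℝ) (hα : IsAlgebraic ℚ α) :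
    ∃ (a : ℤ) (e : ℕ) (A : ℝ) (c : ℕ → ℕ → ℤ), a ≠ 0 ∧ |(a : ℝ)| ≤ A ∧ 1 ≤ A ∧
      (∀ k, ((a : ℝ) * α) ^ k = ∑ l ∈ Finset.range (e + 1), (c k l : ℝ) * ((a : ℝ) * α) ^ l) ∧
      ∀ k l, |(c k l : ℝ)| ≤ A ^ k := by
  have h1 : IsAlgebraic ℤ α := (IsFractionRing.isAlgebraic_iff ℤ ℚ ℝ).mpr hα
  obtain ⟨a, ha, g, hg, hg0⟩ := h1.exists_integral_multiple
  have hγ : a • α = (a : ℝ) * α := by simp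
  rw [hγ] at hg0
  set γ := (a : ℝ) * α with hγdef
  have hd : g.natDegree ≠ 0 := by
    intro hd
    rw [hg.natDegree_eq_zero] at hd
    simp [hd] at hg0
  obtain ⟨e, he⟩ := Nat.exists_eq_succ_of_ne_zero hd
  have hrel : γ ^ (e + 1) = ∑ l ∈ Finset.range (e + 1), ((-g.coeff l : ℤ) : ℝ) * γ ^ l := by
    rw [hg.as_sum, he] at hg0
    simp only [Polynomial.eval₂_add, Polynomial.eval₂_pow, Polynomial.eval₂_X,
      Polynomial.eval₂_finsetSum, Polynomial.eval₂_mul, Polynomial.eval₂_C] at hg0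
    push_cast
    simp only [neg_mul, Finset.sum_neg_distrib]
    simp at hg0
    linarith
  set B : ℝ := ∑ l ∈ Finset.range (e + 1), |((-g.coeff l : ℤ) : ℝ)| with hB
  have hB0 : 0 ≤ B := Finset.sum_nonneg fun _ _ => abs_nonneg _
  set A : ℝ := 1 + B + |(a : ℝ)| with hA
  have hA1 : 1 ≤ A := by rw [hA]; have := abs_nonneg (a : ℝ); linarith
  have key : ∀ k : ℕ, ∃ c : ℕ → ℤ, γ ^ k = ∑ l ∈ Finset.range (e + 1), (c l : ℝ) * γ ^ l ∧
      ∀ l, |(c l : ℝ)| ≤ A ^ k := by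
    intro k
    induction k with
    | zero =>
      refine ⟨fun l => if l = 0 then 1 else 0, ?_, ?_⟩
      · rw [Finset.sum_eq_single 0]
        · simp
        · intro b _ hb; simp [hb]
        · simp
      · intro l; by_cases hl : l = 0 <;> simp [hl]
    | succ k ih =>
      obtain ⟨c, hc, hcb⟩ := ih
      refine ⟨fun l => (if l = 0 then 0 else c (l - 1)) +
        (if l < e + 1 then c e * (-g.coeff l) else 0), ?_, ?_⟩
      · rw [pow_succ, hc, Finset.sum_mul, Finset.sum_range_succ]
        have h2 : (c e : ℝ) * γ ^ e * γ = ∑ l ∈ Finset.range (e + 1),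
            (((if l < e + 1 then c e * (-g.coeff l) else 0 : ℤ)) : ℝ) * γ ^ l := by
          rw [mul_assoc, ← pow_succ, hrel, Finset.mul_sum]
          refine Finset.sum_congr rfl fun l hl => ?_
          rw [if_pos (Finset.mem_range.mp hl)]
          push_cast; ring
        have h3 : ∑ x ∈ Finset.range e, (c x : ℝ) * γ ^ x * γ = ∑ l ∈ Finset.range (e + 1),
            ((if l = 0 then 0 else c (l - 1) : ℤ) : ℝ) * γ ^ l := by
          rw [Finset.sum_range_succ']
          simp [pow_succ, mul_assoc]
        rw [h2, h3, ← Finset.sum_add_distrib]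
        refine Finset.sum_congr rfl fun l hl => ?_
        rw [Int.cast_add, add_mul]
      · intro l
        rw [Int.cast_add]
        refine (abs_add_le _ _).trans ?_
        have hAk : 0 ≤ A ^ k := by positivity
        have h4 : |((if l = 0 then 0 else c (l - 1) : ℤ) : ℝ)| ≤ A ^ k := by
          split_ifs
          · simpa using hAk
          · exact hcb _
        have h5 : |((if l < e + 1 then c e * (-g.coeff l) else 0 : ℤ) : ℝ)| ≤ A ^ k * B := by
          split_ifs with hl
          · rw [Int.cast_mul, abs_mul]
            gcongr
            · exact hcb _
            · exact Finset.single_le_sum (f := fun l => |((-g.coeff l : ℤ) : ℝ)|)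
                (fun _ _ => abs_nonneg _) (Finset.mem_range.mpr hl)
          · simp; positivity
        rw [pow_succ]
        have : A ^ k + A ^ k * B ≤ A ^ k * A := by
          rw [hA] at hAk ⊢
          nlinarith [abs_nonneg (a : ℝ)]
        linarith
  choose c hc hcb using key
  exact ⟨a, e, A, c, ha, by rw [hA]; linarith, hA1, hc, hcb⟩

lemma siegel {I J : Type*} [Fintype I] [Fintype J] (A : Matrix I J ℤ)
    (h2 : 2 * Fintype.card I ≤ Fintype.card J) (hI : 0 < Fintype.card I) (E : ℝ) (hE : 1 ≤ E)
    (hA : ∀ i j, |(A i j : ℝ)| ≤ E) :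
    ∃ t : J → ℤ, t ≠ 0 ∧ A.mulVec t = 0 ∧ ∀ j, |(t j : ℝ)| ≤ Fintype.card J * E := by
  obtain ⟨t, ht0, hAt, hn⟩ := Int.Matrix.exists_ne_zero_int_vec_norm_le A (by omega) hI
  refine ⟨t, ht0, hAt, fun j => ?_⟩
  have h1 : |(t j : ℝ)| ≤ ‖t‖ := by
    have := norm_le_pi_norm t j
    rwa [Int.norm_eq_abs] at this
  refine h1.trans (hn.trans ?_)
  have hI' : (0 : ℝ) < Fintype.card I := by exact_mod_cast hI
  have h2' : 2 * (Fintype.card I : ℝ) ≤ Fintype.card J := by exact_mod_cast h2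
  have h1J : (1 : ℝ) ≤ Fintype.card J := by
    have : 1 ≤ Fintype.card J := by omega
    exact_mod_cast this
  have h3 : ((Fintype.card I : ℝ) / (Fintype.card J - Fintype.card I)) ≤ 1 := by
    rw [div_le_one (by linarith)]; linarith
  refine (Real.rpow_le_rpow_of_exponent_le
    (one_le_mul_of_one_le_of_one_le h1J (le_max_left _ _)) h3).trans ?_
  rw [Real.rpow_one]
  gcongr
  refine max_le hE ?_
  rw [Matrix.norm_le_iff (by linarith)]
  intro i j
  rw [Int.norm_eq_abs]
  exact hA i j

lemma one_factor (r : ℕ) (hr : 0 < r) (θ l : ℝ) (hθ : 0 < θ) (hθ2 : θ < 1 / 2)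
    (hl : l = (1 / 2 - θ) / 2) :
    ∑ i : Fin (r + 1), Real.exp (l * (θ - (i : ℕ) / (r : ℝ))) ≤ (1 - l ^ 2) * (r + 1) := by
  have hr' : (0 : ℝ) < r := by exact_mod_cast hr
  have hl0 : 0 < l := by rw [hl]; linarith
  have hl1 : l ≤ 1 := by rw [hl]; linarith
  have h1 : ∀ i : Fin (r + 1), Real.exp (l * (θ - (i : ℕ) / (r : ℝ))) ≤
      1 + l * (θ - (i : ℕ) / (r : ℝ)) + l ^ 2 := by
    intro i
    set y : ℝ := (i : ℕ) / (r : ℝ) with hy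
    have hy0 : 0 ≤ y := by positivity
    have hy1 : y ≤ 1 := by
      rw [hy, div_le_one hr']
      exact_mod_cast Nat.lt_succ_iff.mp i.2
    have h2 : |θ - y| ≤ 1 := by rw [abs_le]; constructor <;> linarith
    have h3 : |l * (θ - y)| ≤ 1 := by
      rw [abs_mul, abs_of_pos hl0]
      nlinarith [abs_nonneg (θ - y)]
    have h4 := (abs_le.mp (Real.abs_exp_sub_one_sub_id_le h3)).2
    have h5 : (l * (θ - y)) ^ 2 ≤ l ^ 2 := by
      rw [mul_pow]
      have : (θ - y) ^ 2 ≤ 1 := by rw [sq_le_one_iff_abs_le_one]; exact h2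
      nlinarith [sq_nonneg l]
    linarith
  refine (Finset.sum_le_sum fun i _ => h1 i).trans ?_
  rw [Fin.sum_univ_eq_sum_range (fun i => 1 + l * (θ - (i : ℝ) / (r : ℝ)) + l ^ 2) (r + 1)]
  have h6 : ∑ i ∈ Finset.range (r + 1), (i : ℝ) = (r + 1) * r / 2 := by
    have := Finset.sum_range_id_mul_two (r + 1)
    have h7 : ((∑ i ∈ Finset.range (r + 1), i : ℕ) : ℝ) * 2 = (r + 1) * r := by
      exact_mod_cast this
    push_cast at h7
    linarith
  have h8 : ∑ i ∈ Finset.range (r + 1), (1 + l * (θ - (i : ℝ) / (r : ℝ)) + l ^ 2) =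
      (r + 1) * (1 + l * θ + l ^ 2) - l / r * ∑ i ∈ Finset.range (r + 1), (i : ℝ) := by
    rw [Finset.mul_sum]
    have : (r + 1 : ℝ) * (1 + l * θ + l ^ 2) =
      ∑ i ∈ Finset.range (r + 1), (1 + l * θ + l ^ 2) := by
      rw [Finset.sum_const, Finset.card_range, nsmul_eq_mul]; push_cast; ring
    rw [this, ← Finset.sum_sub_distrib]
    refine Finset.sum_congr rfl fun i _ => ?_
    ring
  rw [h8, h6]
  have h9 : l / r * ((r + 1) * r / 2) = l * (r + 1) / 2 := by field_simp
  rw [h9]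
  have : θ = 1 / 2 - 2 * l := by rw [hl]; ring
  rw [this]
  nlinarith

lemma card_le_sum (J : Type*) [Fintype J] (p : J → Prop) [DecidablePred p] (w : J → ℝ)
    (hw0 : ∀ i, 0 ≤ w i) (hw1 : ∀ i, p i → 1 ≤ w i) :
    ((Finset.univ.filter p).card : ℝ) ≤ ∑ i, w i := by
  have h1 := Finset.card_nsmul_le_sum (Finset.univ.filter p) w 1
    (fun i hi => hw1 i (Finset.mem_filter.mp hi).2)
  rw [nsmul_eq_mul, mul_one] at h1
  exact h1.trans (Finset.sum_le_sum_of_subset_of_nonneg (Finset.filter_subset _ _)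
    (fun i _ _ => hw0 i))

lemma count_low (m : ℕ) (r : Fin m → ℕ) (hr : ∀ h, 0 < r h) (θ l : ℝ) (hθ : 0 < θ)
    (hθ2 : θ < 1 / 2) (hl : l = (1 / 2 - θ) / 2) :
    (Fintype.card {i : (h : Fin m) → Fin (r h + 1) //
      ∑ h, ((i h : ℕ) : ℝ) / r h < θ * m} : ℝ) ≤
      (1 - l ^ 2) ^ m * Fintype.card ((h : Fin m) → Fin (r h + 1)) := by
  classical
  have hl0 : 0 < l := by rw [hl]; linarith
  have hrw : Fintype.card {i : (h : Fin m) → Fin (r h + 1) //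
      ∑ h, ((i h : ℕ) : ℝ) / r h < θ * m} = (Finset.univ.filter
        (fun i : (h : Fin m) → Fin (r h + 1) => ∑ h, ((i h : ℕ) : ℝ) / r h < θ * m)).card :=
    Fintype.card_subtype _
  rw [hrw]
  have hw0 : ∀ i : (h : Fin m) → Fin (r h + 1),
      0 ≤ ∏ h, Real.exp (l * (θ - (i h : ℕ) / (r h : ℝ))) := fun i =>
    Finset.prod_nonneg fun h _ => (Real.exp_pos _).le
  have hw1 : ∀ i : (h : Fin m) → Fin (r h + 1), ∑ h, ((i h : ℕ) : ℝ) / r h < θ * m →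
      1 ≤ ∏ h, Real.exp (l * (θ - (i h : ℕ) / (r h : ℝ))) := by
    intro i hi
    rw [← Real.exp_sum]
    apply Real.one_le_exp
    rw [← Finset.mul_sum, Finset.sum_sub_distrib]
    simp only [Finset.sum_const, Finset.card_univ, Fintype.card_fin, nsmul_eq_mul]
    apply mul_nonneg hl0.le
    linarith
  have h1 := card_le_sum _ (fun i : (h : Fin m) → Fin (r h + 1) =>
    ∑ h, ((i h : ℕ) : ℝ) / r h < θ * m) _ hw0 hw1
  refine h1.trans ?_
  rw [← Fintype.prod_sum (fun h (x : Fin (r h + 1)) =>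
    Real.exp (l * (θ - (x : ℕ) / (r h : ℝ))))]
  refine (Finset.prod_le_prod (fun h _ => Finset.sum_nonneg fun _ _ => by positivity)
    (fun h _ => one_factor (r h) (hr h) θ l hθ hθ2 hl)).trans ?_
  rw [Finset.prod_mul_distrib]
  simp

end RothAux

namespace RothAux

open MvPolynomial

/-- exponent vector attached to a bounded index -/
noncomputable def toF {m : ℕ} {r : Fin m → ℕ} (j : (h : Fin m) → Fin (r h + 1)) : Fin m →₀ ℕ :=
  Finsupp.equivFunOnFinite.symm (fun h => (j h : ℕ))

lemma toF_apply {m : ℕ} {r : Fin m → ℕ} (j : (h : Fin m) → Fin (r h + 1)) (h : Fin m) :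
    toF j h = (j h : ℕ) := rfl

lemma toF_inj {m : ℕ} {r : Fin m → ℕ} {j k : (h : Fin m) → Fin (r h + 1)} (hjk : toF j = toF k) :
    j = k := by
  funext h
  have := DFunLike.congr_fun hjk h
  rw [toF_apply, toF_apply] at this
  exact Fin.ext this

lemma coeff_T_sum {m : ℕ} {r : Fin m → ℕ} (t : ((h : Fin m) → Fin (r h + 1)) → ℤ) (α : ℝ)
    (a : Fin m →₀ ℕ) :
    coeff a (T (fun _ => α) (∑ j, monomial (toF j) (t j : ℝ))) =
      ∑ j, (t j : ℝ) * (∏ h, ((j h : ℕ).choose (a h) : ℝ)) * α ^ (∑ h, ((j h : ℕ) - a h)) := by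
  rw [coeff_T, map_sum, map_sum]
  refine Finset.sum_congr rfl fun j _ => ?_
  rw [D_monomial, eval_monomial]
  congr 1
  rw [Finsupp.prod_fintype _ _ (by simp), Finset.prod_pow_eq_pow_sum]
  simp [toF_apply]

lemma aux_fixed (α : ℝ) (a₀ : ℤ) (e : ℕ) (A : ℝ) (c : ℕ → ℕ → ℤ) (ha₀ : a₀ ≠ 0)
    (ha₀A : |(a₀ : ℝ)| ≤ A) (hA : 1 ≤ A)
    (hc : ∀ k, ((a₀ : ℝ) * α) ^ k =
      ∑ l ∈ Finset.range (e + 1), (c k l : ℝ) * ((a₀ : ℝ) * α) ^ l)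
    (hcA : ∀ k l, |(c k l : ℝ)| ≤ A ^ k) (m : ℕ) (hm : 0 < m) (θ l : ℝ) (hθ : 0 < θ)
    (hθ2 : θ < 1 / 2) (hl : l = (1 / 2 - θ) / 2) (hlm : (e + 1) * (1 - l ^ 2) ^ m ≤ 1 / 2)
    (r : Fin m → ℕ) (hr : ∀ h, 0 < r h) :
    ∃ P : MP m, P ≠ 0 ∧ P ∈ ZP m ∧ (∀ h, DegLE h (r h) P) ∧ L1 P ≤ (8 * A) ^ (∑ h, r h) ∧
      ∀ a, wt r a < θ * m → coeff a (T (fun _ => α) P) = 0 := by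
  classical
  set R := ∑ h, r h with hR
  let J := (h : Fin m) → Fin (r h + 1)
  let I := {i : J // ∑ h, ((i h : ℕ) : ℝ) / r h < θ * m} × Fin (e + 1)
  let K : I → J → ℕ := fun i j => ∑ h, ((j h : ℕ) - (i.1.1 h : ℕ))
  let Mx : Matrix I J ℤ := fun i j =>
    (((∏ h, (j h : ℕ).choose (i.1.1 h : ℕ) : ℕ)) : ℤ) * (a₀ ^ (R - K i j) * c (K i j) i.2)
  have hK : ∀ i j, K i j ≤ R := by
    intro i j
    refine Finset.sum_le_sum fun h _ => ?_
    have := (j h).2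
    omega
  have hcardJ : (Fintype.card J : ℝ) ≤ 2 ^ R := by
    have h1 : Fintype.card J = ∏ h, (r h + 1) := by simp [J]
    rw [h1, hR, ← Finset.prod_pow_eq_pow_sum]
    push_cast
    refine Finset.prod_le_prod (fun _ _ => by positivity) fun h _ => ?_
    exact_mod_cast Nat.lt_two_pow_self
  have hcard : 2 * Fintype.card I ≤ Fintype.card J := by
    have h1 := count_low m r hr θ l hθ hθ2 hl
    have h2 : (Fintype.card I : ℝ) = Fintype.card {i : J // ∑ h, ((i h : ℕ) : ℝ) / r h < θ * m} *
        (e + 1) := by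
      simp only [I, Fintype.card_prod, Fintype.card_fin]
      push_cast
      rfl
    have h3 : 2 * (Fintype.card I : ℝ) ≤ Fintype.card J := by
      rw [h2]
      have h4 : (0 : ℝ) ≤ Fintype.card J := Nat.cast_nonneg _
      calc 2 * ((Fintype.card {i : J // ∑ h, ((i h : ℕ) : ℝ) / r h < θ * m} : ℝ) * (e + 1))
          ≤ 2 * (((1 - l ^ 2) ^ m * Fintype.card J) * (e + 1)) := by gcongr
        _ = 2 * ((e + 1) * (1 - l ^ 2) ^ m) * Fintype.card J := by ring
        _ ≤ 2 * (1 / 2) * Fintype.card J := by gcongr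
        _ = _ := by ring
    exact_mod_cast h3
  have hI : 0 < Fintype.card I := by
    refine Fintype.card_pos_iff.mpr ⟨⟨⟨fun _ => 0, ?_⟩, 0⟩⟩
    simp
    positivity
  have hE : ∀ i j, |(Mx i j : ℝ)| ≤ (2 * A) ^ R := by
    intro i j
    simp only [Mx]
    rw [Int.cast_mul, abs_mul, mul_pow]
    gcongr
    · push_cast
      rw [abs_of_nonneg (by positivity), hR, ← Finset.prod_pow_eq_pow_sum]
      refine Finset.prod_le_prod (fun _ _ => by positivity) fun h _ => ?_
      have h5 : (j h : ℕ).choose (i.1.1 h) ≤ 2 ^ r h :=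
        (Nat.choose_le_two_pow _ _).trans
          (Nat.pow_le_pow_right (by norm_num) (Nat.lt_succ_iff.mp (j h).2))
      exact_mod_cast h5
    · push_cast
      rw [abs_mul, abs_pow]
      calc |(a₀ : ℝ)| ^ (R - K i j) * |(c (K i j) i.2 : ℝ)| ≤ A ^ (R - K i j) * A ^ K i j := by
            gcongr
            exact hcA _ _
        _ = A ^ R := by rw [← pow_add, Nat.sub_add_cancel (hK i j)]
  obtain ⟨t, ht0, hMt, htb⟩ := siegel Mx hcard hI ((2 * A) ^ R)
    (one_le_pow₀ (by linarith)) hE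
  have hcoeff : ∀ j : J, coeff (toF j) (∑ j : J, monomial (toF j) (t j : ℝ) : MP m) = t j := by
    intro j
    rw [coeff_sum, Finset.sum_eq_single j]
    · simp
    · intro k _ hk
      rw [coeff_monomial, if_neg]
      intro h; exact hk (toF_inj h)
    · simp
  refine ⟨∑ j : J, monomial (toF j) (t j : ℝ), ?_, ?_, ?_, ?_, ?_⟩
  · intro h
    apply ht0
    funext j
    have := hcoeff j
    rw [h, coeff_zero] at this
    exact_mod_cast this.symm
  · refine Subring.sum_mem _ fun j _ => ?_
    rw [mem_ZP]
    intro a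
    rw [coeff_monomial]
    split_ifs
    · exact ⟨_, rfl⟩
    · exact ⟨0, by simp⟩
  · intro h
    refine GE.sum _ fun j _ => ?_
    refine DegLE_monomial _ ?_
    rw [toF_apply]
    exact Nat.lt_succ_iff.mp (j h).2
  · refine (L1_sum _ _).trans ?_
    calc ∑ j : J, L1 (monomial (toF j) (t j : ℝ) : MP m)
        ≤ ∑ j : J, (Fintype.card J * (2 * A) ^ R : ℝ) :=
          Finset.sum_le_sum fun j _ => (L1_monomial _ _).trans (htb j)
      _ = Fintype.card J * (Fintype.card J * (2 * A) ^ R) := by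
          rw [Finset.sum_const, Finset.card_univ, nsmul_eq_mul]
      _ ≤ 2 ^ R * (2 ^ R * (2 * A) ^ R) := by gcongr
      _ = (8 * A) ^ R := by rw [← mul_pow, ← mul_pow]; ring_nf
  · intro a ha
    rw [coeff_T_sum]
    by_cases hle : ∀ h, a h ≤ r h
    · let i : J := fun h => ⟨a h, Nat.lt_succ_of_le (hle h)⟩
      have hi : ∑ h, ((i h : ℕ) : ℝ) / r h < θ * m := by
        rw [wt_apply] at ha; exact ha
      have ha₀' : (a₀ : ℝ) ^ R ≠ 0 := pow_ne_zero _ (by exact_mod_cast ha₀)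
      apply (mul_eq_zero.mp ?_).resolve_left ha₀'
      have hrow : ∀ x : Fin (e + 1), ∑ j : J, (Mx (⟨i, hi⟩, x) j : ℝ) * t j = 0 := by
        intro x
        have := congrFun hMt (⟨i, hi⟩, x)
        simp only [Matrix.mulVec, dotProduct, Pi.zero_apply] at this
        exact_mod_cast this
      calc (a₀ : ℝ) ^ R * ∑ j : J, (t j : ℝ) * (∏ h, ((j h : ℕ).choose (a h) : ℝ)) *
            α ^ (∑ h, ((j h : ℕ) - a h))
          = ∑ j : J, ∑ x : Fin (e + 1), ((Mx (⟨i, hi⟩, x) j : ℝ) * t j) *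
              ((a₀ : ℝ) * α) ^ (x : ℕ) := by
            rw [Finset.mul_sum]
            refine Finset.sum_congr rfl fun j _ => ?_
            set k := ∑ h, ((j h : ℕ) - a h) with hk
            have hkR : k ≤ R := hK (⟨i, hi⟩, 0) j
            have hMx : ∀ x : Fin (e + 1), (Mx (⟨i, hi⟩, x) j : ℝ) =
                (∏ h, ((j h : ℕ).choose (a h) : ℝ)) * ((a₀ : ℝ) ^ (R - k) * c k x) := by
              intro x
              simp only [Mx]
              push_cast
              rfl
            have h6 : (a₀ : ℝ) ^ R * α ^ k = (a₀ : ℝ) ^ (R - k) * ((a₀ : ℝ) * α) ^ k := by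
              rw [mul_pow, ← mul_assoc, ← pow_add, Nat.sub_add_cancel hkR]
            calc (a₀ : ℝ) ^ R * ((t j : ℝ) * (∏ h, ((j h : ℕ).choose (a h) : ℝ)) * α ^ k)
                = (t j : ℝ) * (∏ h, ((j h : ℕ).choose (a h) : ℝ)) * ((a₀ : ℝ) ^ R * α ^ k) := by
                  ring
              _ = _ := by
                  rw [h6, hc k, ← Fin.sum_univ_eq_sum_range
                    (fun l => (c k l : ℝ) * ((a₀ : ℝ) * α) ^ l) (e + 1), Finset.mul_sum,
                    Finset.mul_sum]
                  refine Finset.sum_congr rfl fun x _ => ?_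
                  rw [hMx]
                  ring
        _ = ∑ x : Fin (e + 1), (∑ j : J, (Mx (⟨i, hi⟩, x) j : ℝ) * t j) *
              ((a₀ : ℝ) * α) ^ (x : ℕ) := by
            rw [Finset.sum_comm]
            refine Finset.sum_congr rfl fun x _ => ?_
            rw [Finset.sum_mul]
        _ = 0 := by simp [hrow]
    · push Not at hle
      obtain ⟨h, hh⟩ := hle
      refine Finset.sum_eq_zero fun j _ => ?_
      have : (∏ h, ((j h : ℕ).choose (a h) : ℝ)) = 0 := by
        refine Finset.prod_eq_zero (Finset.mem_univ h) ?_
        rw [Nat.choose_eq_zero_of_lt (by have := (j h).2; omega)]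
        simp
      rw [this]; simp

lemma aux_poly (α : ℝ) (hα : IsAlgebraic ℚ α) (θ : ℝ) (hθ : 0 < θ) (hθ2 : θ < 1 / 2) :
    ∃ m : ℕ, 0 < m ∧ ∃ B : ℝ, 1 ≤ B ∧ ∀ r : Fin m → ℕ, (∀ h, 0 < r h) →
    ∃ P : MP m, P ≠ 0 ∧ P ∈ ZP m ∧ (∀ h, DegLE h (r h) P) ∧ L1 P ≤ B ^ (∑ h, r h) ∧
      ∀ a, wt r a < θ * m → coeff a (T (fun _ => α) P) = 0 := by
  obtain ⟨a₀, e, A, c, ha₀, ha₀A, hA, hc, hcA⟩ := alg_powers α hα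
  set l := (1 / 2 - θ) / 2 with hl
  have hl0 : 0 < l := by rw [hl]; linarith
  have hl1 : l ≤ 1 := by rw [hl]; linarith
  obtain ⟨m, hm⟩ := exists_pow_lt_of_lt_one (show (0 : ℝ) < 1 / (2 * (e + 1)) by positivity)
    (show 1 - l ^ 2 < 1 by nlinarith)
  have hx0 : 0 ≤ 1 - l ^ 2 := by nlinarith
  refine ⟨m + 1, Nat.succ_pos _, 8 * A, by linarith, ?_⟩
  intro r hr
  refine aux_fixed α a₀ e A c ha₀ ha₀A hA hc hcA (m + 1) (Nat.succ_pos _) θ l hθ hθ2 hl ?_ r hr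
  have h1 : (1 - l ^ 2) ^ (m + 1) ≤ (1 - l ^ 2) ^ m :=
    pow_le_pow_of_le_one hx0 (by nlinarith) (Nat.le_succ m)
  have h2 : (1 - l ^ 2) ^ (m + 1) ≤ 1 / (2 * (e + 1)) := h1.trans hm.le
  rw [le_div_iff₀ (by positivity)] at h2
  linarith

end RothAux

namespace RothAux

open MvPolynomial

lemma abs_eval_le {m : ℕ} (F : MP m) (y : Fin m → ℝ) (E : ℝ)
    (hE : ∀ a, coeff a F ≠ 0 → ∏ h, |y h| ^ a h ≤ E) : |eval y F| ≤ L1 F * E := by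
  rw [eval_eq', L1, Finset.sum_mul]
  refine (Finset.abs_sum_le_sum_abs _ _).trans (Finset.sum_le_sum fun a ha => ?_)
  rw [abs_mul, Finset.abs_prod]
  simp only [abs_pow]
  exact mul_le_mul_of_nonneg_left (hE a (mem_support_iff.mp ha)) (abs_nonneg _)

lemma eval_T {m : ℕ} (F : MP m) (x y : Fin m → ℝ) :
    eval y (T x F) = eval (fun h => y h + x h) F := by
  have : (eval y).comp (T x).toRingHom = eval (fun h => y h + x h) := by
    ext i
    · simp [T]
    · simp [T]
  exact congrArg (fun φ => φ F) this

lemma L1_T {m : ℕ} (F : MP m) (r : Fin m → ℕ) (hF : ∀ h, DegLE h (r h) F) (x : Fin m → ℝ) (b : ℝ)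
    (hx : ∀ h, |x h| ≤ b) (hb : 0 ≤ b) : L1 (T x F) ≤ (1 + b) ^ (∑ h, r h) * L1 F := by
  have h1 : ∀ h : Fin m, L1 (X h + C (x h) : MP m) ≤ 1 + b := by
    intro h
    refine (L1_add _ _).trans ?_
    have h2 : L1 (X h : MP m) ≤ 1 := by
      have := L1_monomial (m := m) (Finsupp.single h 1) 1
      simpa [X] using this
    have h3 : L1 (C (x h) : MP m) ≤ |x h| := L1_monomial 0 (x h)
    linarith [hx h]
  have h4 : ∀ a ∈ F.support, L1 (T x (monomial a (coeff a F))) ≤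
      |coeff a F| * (1 + b) ^ (∑ h, r h) := by
    intro a ha
    have h5 : T x (monomial a (coeff a F)) = C (coeff a F) * ∏ h, (X h + C (x h)) ^ a h := by
      rw [T, aeval_monomial, Finsupp.prod_fintype _ _ (by simp)]
      rfl
    rw [h5]
    refine (L1_C_mul _ _).trans ?_
    gcongr
    refine (L1_prod _ _).trans ?_
    rw [← Finset.prod_pow_eq_pow_sum]
    refine Finset.prod_le_prod (fun _ _ => L1_nonneg _) fun h _ => ?_
    refine (L1_pow _ _).trans ?_
    calc L1 (X h + C (x h) : MP m) ^ a h ≤ (1 + b) ^ a h :=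
          pow_le_pow_left₀ (L1_nonneg _) (h1 h) _
      _ ≤ (1 + b) ^ r h := pow_le_pow_right₀ (by linarith)
          (degLE_iff.mp (hF h) a (mem_support_iff.mp ha))
  calc L1 (T x F) = L1 (∑ a ∈ F.support, T x (monomial a (coeff a F))) := by
        rw [← map_sum, ← F.as_sum]
    _ ≤ ∑ a ∈ F.support, L1 (T x (monomial a (coeff a F))) := L1_sum _ _
    _ ≤ ∑ a ∈ F.support, |coeff a F| * (1 + b) ^ (∑ h, r h) := Finset.sum_le_sum h4
    _ = _ := by rw [← Finset.sum_mul, L1, mul_comm]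

lemma eval_lower {m : ℕ} (F : MP m) (r : Fin m → ℕ) (hF : ∀ h, DegLE h (r h) F) (hZ : F ∈ ZP m)
    (p : Fin m → ℤ) (q : Fin m → ℕ) (hq : ∀ h, 0 < q h)
    (hne : eval (fun h => (p h : ℝ) / q h) F ≠ 0) :
    1 ≤ (∏ h, (q h : ℝ) ^ r h) * |eval (fun h => (p h : ℝ) / q h) F| := by
  have hpos : 0 < ∏ h, (q h : ℝ) ^ r h :=
    Finset.prod_pos fun h _ => by have := hq h; positivity
  rw [mem_ZP] at hZ
  choose z hz using hZ
  have h1 : (∏ h, (q h : ℝ) ^ r h) * eval (fun h => (p h : ℝ) / q h) F =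
      ((∑ a ∈ F.support, z a * ∏ h, (p h ^ a h * (q h : ℤ) ^ (r h - a h)) : ℤ) : ℝ) := by
    rw [eval_eq', Finset.mul_sum]
    push_cast
    refine Finset.sum_congr rfl fun a ha => ?_
    rw [hz, mul_left_comm, ← Finset.prod_mul_distrib]
    congr 1
    refine Finset.prod_congr rfl fun h _ => ?_
    have hle := degLE_iff.mp (hF h) a (mem_support_iff.mp ha)
    have hq' : (q h : ℝ) ≠ 0 := by have := hq h; positivity
    rw [← Nat.sub_add_cancel hle, pow_add, Nat.add_sub_cancel, div_pow]
    field_simp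
  rw [← abs_of_pos hpos, ← abs_mul, h1]
  rw [← Int.cast_abs]
  have : (∑ a ∈ F.support, z a * ∏ h, (p h ^ a h * (q h : ℤ) ^ (r h - a h)) : ℤ) ≠ 0 := by
    intro h0
    rw [h0, Int.cast_zero] at h1
    exact (mul_ne_zero hpos.ne' hne) h1
  exact_mod_cast Int.one_le_abs this

/-- Core estimate: the final contradiction for fixed data. -/
lemma core {m : ℕ} (hm : 0 < m) (α κ θ ε B M : ℝ) (hκ : 0 < κ) (hε : 0 < ε)
    (hB : 1 ≤ B) (hM : 0 < M)
    (hmain : 1 + 2 * ε < κ * (θ - ε)) (r : Fin m → ℕ) (hr : ∀ h, 0 < r h)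
    (p : Fin m → ℤ) (q : Fin m → ℕ) (hq : ∀ h, 0 < q h) (P : MP m)
    (hZ : P ∈ ZP m) (hd : ∀ h, DegLE h (r h) P) (hL : L1 P ≤ B ^ (∑ h, r h))
    (hvan : ∀ a, wt r a < θ * m → coeff a (T (fun _ => α) P) = 0)
    (hM1 : ∀ h, M ≤ r h * Real.log (q h)) (hM2 : ∀ h, r h * Real.log (q h) ≤ (1 + ε) * M)
    (hG : ∀ h, (r h : ℝ) * Real.log ((1 + |α|) * (2 * B)) ≤ ε * M)
    (happ : ∀ h, |α - p h / q h| ≤ Real.exp (-κ * Real.log (q h)))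
    (a : Fin m →₀ ℕ) (haw : wt r a ≤ ε)
    (hac : coeff a (T (fun h => (p h : ℝ) / q h) P) ≠ 0) : False := by
  rw [coeff_T] at hac
  have hm1 : (1 : ℝ) ≤ m := by exact_mod_cast hm
  have hdQ : ∀ h, DegLE h (r h) (D a P) := fun h => (hd h).D a
  have hlow := eval_lower (D a P) r hdQ (D_mem_ZP hZ a) p q hq hac
  set β : Fin m → ℝ := fun h => (p h : ℝ) / q h with hβ
  have hprod : ∏ h, (q h : ℝ) ^ r h ≤ Real.exp (m * ((1 + ε) * M)) := by
    have h1 : ∏ h, (q h : ℝ) ^ r h = Real.exp (∑ h, r h * Real.log (q h)) := by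
      rw [Real.exp_sum]
      refine Finset.prod_congr rfl fun h _ => ?_
      rw [Real.exp_nat_mul, Real.exp_log (by have := hq h; positivity)]
    rw [h1]
    apply Real.exp_le_exp.mpr
    calc ∑ h, (r h : ℝ) * Real.log (q h) ≤ ∑ h : Fin m, (1 + ε) * M :=
          Finset.sum_le_sum fun h _ => hM2 h
      _ = _ := by simp
  have heval : eval β (D a P) = eval (fun h => β h - α) (T (fun _ => α) (D a P)) := by
    rw [eval_T]; simp
  have hup : |eval β (D a P)| ≤ L1 (T (fun _ => α) (D a P)) *
      Real.exp (-κ * (M * ((θ - ε) * m))) := by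
    rw [heval]
    apply abs_eval_le
    intro j hj
    rw [← D_T, coeff_D] at hj
    have h1 : θ * m ≤ wt r (j + a) := by
      by_contra hlt
      exact left_ne_zero_of_mul hj (hvan _ (not_le.mp hlt))
    rw [map_add] at h1
    have h2 : (θ - ε) * m ≤ wt r j := by nlinarith
    calc ∏ h, |β h - α| ^ j h ≤ ∏ h, Real.exp (-κ * (j h * Real.log (q h))) := by
          refine Finset.prod_le_prod (fun _ _ => by positivity) fun h _ => ?_
          have h3 : |β h - α| ≤ Real.exp (-κ * Real.log (q h)) := by
            rw [abs_sub_comm]; exact happ h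
          calc |β h - α| ^ j h ≤ Real.exp (-κ * Real.log (q h)) ^ j h := by gcongr
            _ = _ := by rw [← Real.exp_nat_mul]; ring_nf
      _ = Real.exp (-κ * ∑ h, j h * Real.log (q h)) := by
          rw [← Real.exp_sum, Finset.mul_sum]
      _ ≤ _ := by
          apply Real.exp_le_exp.mpr
          have h4 : M * wt r j ≤ ∑ h, j h * Real.log (q h) := by
            rw [wt_apply, Finset.mul_sum]
            refine Finset.sum_le_sum fun h _ => ?_
            have hrh : (0 : ℝ) < r h := by exact_mod_cast hr h
            calc M * ((j h : ℝ) / r h) ≤ (r h * Real.log (q h)) * ((j h : ℝ) / r h) := by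
                  gcongr; exact hM1 h
              _ = _ := by field_simp
          have h5 : M * ((θ - ε) * m) ≤ M * wt r j := by gcongr
          nlinarith
  have hL1 : L1 (T (fun _ => α) (D a P)) ≤ Real.exp (m * (ε * M)) := by
    have h1 := L1_T (D a P) r hdQ (fun _ => α) |α| (fun _ => le_rfl) (abs_nonneg _)
    have h2 := L1_D hd a
    have hG0 : 0 < (1 + |α|) * (2 * B) := by have := abs_nonneg α; positivity
    calc L1 (T (fun _ => α) (D a P)) ≤ (1 + |α|) ^ (∑ h, r h) * L1 (D a P) := h1
      _ ≤ (1 + |α|) ^ (∑ h, r h) * (2 ^ (∑ h, r h) * B ^ (∑ h, r h)) := by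
          gcongr
          exact h2.trans (by gcongr)
      _ = ((1 + |α|) * (2 * B)) ^ (∑ h, r h) := by rw [← mul_pow, ← mul_pow]
      _ = Real.exp ((∑ h, r h : ℕ) * Real.log ((1 + |α|) * (2 * B))) := by
          rw [Real.exp_nat_mul, Real.exp_log hG0]
      _ ≤ _ := by
          apply Real.exp_le_exp.mpr
          push_cast
          rw [Finset.sum_mul]
          calc ∑ h, (r h : ℝ) * Real.log ((1 + |α|) * (2 * B)) ≤ ∑ h : Fin m, ε * M :=
                Finset.sum_le_sum fun h _ => hG h
            _ = _ := by simp
  have hfin : (1 : ℝ) ≤ Real.exp (m * ((1 + ε) * M)) * (Real.exp (m * (ε * M)) *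
      Real.exp (-κ * (M * ((θ - ε) * m)))) := by
    refine hlow.trans ?_
    have h6 : |eval β (D a P)| ≤ Real.exp (m * (ε * M)) *
      Real.exp (-κ * (M * ((θ - ε) * m))) := hup.trans (by gcongr)
    gcongr
  rw [← Real.exp_add, ← Real.exp_add] at hfin
  have h7 : 0 ≤ m * ((1 + ε) * M) + (m * (ε * M) + -κ * (M * ((θ - ε) * m))) := by
    exact Real.one_le_exp_iff.mp hfin
  have h8 : m * ((1 + ε) * M) + (m * (ε * M) + -κ * (M * ((θ - ε) * m))) =
      m * M * (1 + 2 * ε - κ * (θ - ε)) := by ring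
  rw [h8] at h7
  have h9 : 0 < m * M := by positivity
  nlinarith

lemma exists_seq (Pr : ℤ → ℕ → Prop) (hPr : ∀ Y : ℝ, ∃ p q, Pr p q ∧ Y ≤ Real.log q)
    (Λ Λ' : ℝ) (hΛ : 0 ≤ Λ) (hΛ' : 1 ≤ Λ') :
    ∃ (p : ℕ → ℤ) (q : ℕ → ℕ), (∀ n, Pr (p n) (q n)) ∧ (∀ n, Λ ≤ Real.log (q n)) ∧
      ∀ h k, h < k → Λ' * Real.log (q h) ≤ Real.log (q k) := by
  choose p q hpq hY using hPr
  let Y : ℕ → ℝ := fun n => Nat.rec Λ (fun _ y => Λ' * Real.log (q y)) n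
  have hs : ∀ n, Λ' * Real.log (q (Y n)) ≤ Real.log (q (Y (n + 1))) := fun n => hY _
  have h0 : ∀ n, 0 ≤ Real.log (q (Y n)) := fun n => Real.log_natCast_nonneg _
  have hmono : Monotone fun n => Real.log (q (Y n)) := by
    apply monotone_nat_of_le_succ
    intro n
    have := hs n
    nlinarith [h0 n]
  refine ⟨fun n => p (Y n), fun n => q (Y n), fun n => hpq _, ?_, ?_⟩
  · intro n
    exact (hY Λ).trans (hmono (Nat.zero_le n))
  · intro h k hk
    exact (hs h).trans (hmono hk)

theorem roth (α : ℝ) (hα : IsAlgebraic ℚ α) (κ : ℝ) (hκ : 2 < κ) :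
    ∃ Y : ℝ, ∀ (p : ℤ) (q : ℕ), 0 < q → IsCoprime p (q : ℤ) → Y ≤ Real.log q →
      Real.exp (-κ * Real.log q) < |α - p / q| := by
  by_contra hcon
  push Not at hcon
  set γ := κ / 2 - 1 with hγ
  have hγ0 : 0 < γ := by rw [hγ]; linarith
  set θ := (1 + γ / 2) / κ with hθ
  have hκ0 : 0 < κ := by linarith
  have hθ0 : 0 < θ := by positivity
  have hθ2 : θ < 1 / 2 := by
    rw [hθ, div_lt_iff₀ hκ0]; linarith
  set ε := γ / (4 * (κ + 2)) with hε
  have hε0 : 0 < ε := by positivity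
  have hmain : 1 + 2 * ε < κ * (θ - ε) := by
    have h1 : κ * θ = 1 + γ / 2 := by rw [hθ]; field_simp
    have h2 : (κ + 2) * ε = γ / 4 := by rw [hε]; field_simp
    nlinarith
  obtain ⟨m, hm, B, hB, haux⟩ := aux_poly α hα θ hθ0 hθ2
  have hm1 : (1 : ℝ) ≤ m := by exact_mod_cast hm
  obtain ⟨δ, hδ, hroth⟩ := roth_lemma (m := m) ε hε0
  set lB := Real.log B with hlB
  have hlB0 : 0 ≤ lB := Real.log_nonneg hB
  set lG := Real.log ((1 + |α|) * (2 * B)) with hlG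
  have hlG0 : 0 ≤ lG := by
    apply Real.log_nonneg
    nlinarith [abs_nonneg α]
  -- the smallness parameter
  obtain ⟨ρ, hρ0, hρ1, hρ2, hρ3⟩ : ∃ ρ : ℝ, 0 < ρ ∧ ρ ≤ δ ∧ m * ρ * lB ≤ δ ∧ ρ * lG ≤ ε := by
    refine ⟨min δ (min (δ / (m * (lB + 1))) (ε / (lG + 1))), by positivity, min_le_left _ _, ?_, ?_⟩
    · set ρ := min δ (min (δ / (m * (lB + 1))) (ε / (lG + 1))) with hρ
      have h0 : 0 < ρ := by positivity
      have : ρ ≤ δ / (m * (lB + 1)) := (min_le_right _ _).trans (min_le_left _ _)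
      rw [le_div_iff₀ (by positivity)] at this
      nlinarith [mul_pos h0 (by linarith : (0 : ℝ) < m)]
    · set ρ := min δ (min (δ / (m * (lB + 1))) (ε / (lG + 1))) with hρ
      have h0 : 0 < ρ := by positivity
      have : ρ ≤ ε / (lG + 1) := (min_le_right _ _).trans (min_le_right _ _)
      rw [le_div_iff₀ (by positivity)] at this
      nlinarith
  obtain ⟨p, q, hpq, hΛ, hrat⟩ := exists_seq
    (fun p q => 0 < q ∧ IsCoprime p (q : ℤ) ∧ |α - p / q| ≤ Real.exp (-κ * Real.log q))
    (fun Y => by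
      obtain ⟨p, q, h1, h2, h3, h4⟩ := hcon Y
      exact ⟨p, q, ⟨h1, h2, h4⟩, h3⟩)
    ((1 + ε) / ρ) (max 1 ((1 + ε) / δ)) (by positivity) (le_max_left _ _)
  set L : ℕ → ℝ := fun n => Real.log (q n) with hL
  have hL0 : ∀ n, 0 < L n := fun n => lt_of_lt_of_le (by positivity) (hΛ n)
  set M : ℝ := (∑ h : Fin m, L h) / ε with hMdef
  have hLM : ∀ h : Fin m, L h ≤ ε * M := by
    intro h
    rw [hMdef, mul_div_cancel₀ _ hε0.ne']
    exact Finset.single_le_sum (f := fun h : Fin m => L h) (fun h _ => (hL0 h).le)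
      (Finset.mem_univ h)
  have hM0 : 0 < M := by
    have h1 := hLM ⟨0, hm⟩
    have h2 := hL0 0
    simp only at h1
    by_contra hneg
    nlinarith
  set r : Fin m → ℕ := fun h => ⌈M / L h⌉₊ with hr
  have hr0 : ∀ h, 0 < r h := fun h => Nat.ceil_pos.mpr (div_pos hM0 (hL0 h))
  have hr1 : ∀ h, M ≤ r h * L h := by
    intro h
    rw [← div_le_iff₀ (hL0 h)]
    exact Nat.le_ceil _
  have hr2 : ∀ h, r h * L h ≤ (1 + ε) * M := by
    intro h
    have h1 : (r h : ℝ) < M / L h + 1 := Nat.ceil_lt_add_one (div_pos hM0 (hL0 h)).le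
    have h2 : (r h : ℝ) * L h ≤ (M / L h + 1) * L h :=
      mul_le_mul_of_nonneg_right h1.le (hL0 h).le
    have h3 : (M / L h + 1) * L h = M + L h := by
      rw [add_mul, div_mul_cancel₀ _ (hL0 h).ne', one_mul]
    linarith [hLM h]
  have hr3 : ∀ h, (r h : ℝ) ≤ ρ * M := by
    intro h
    have h1 := hr2 h
    have h2 : (1 + ε) ≤ ρ * L h := by
      have := hΛ h
      rw [div_le_iff₀ hρ0] at this
      linarith
    have h3 : (r h : ℝ) * L h ≤ (ρ * M) * L h := by nlinarith
    exact le_of_mul_le_mul_right h3 (hL0 h)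
  obtain ⟨P, hP0, hPZ, hPd, hPL, hPv⟩ := haux r hr0
  obtain ⟨a, haw, hac⟩ := hroth r (fun h => p h) (fun h => q h) P M (fun h _ => hr0 h)
    (fun h hh => absurd (Finset.mem_univ h) hh)
    (fun h _ k _ hhk => by
      have h1 : (1 + ε) / δ * L h ≤ L k :=
        (mul_le_mul_of_nonneg_right (le_max_right _ _) (hL0 h).le).trans (hrat h k hhk)
      rw [div_mul_eq_mul_div, div_le_iff₀ hδ] at h1
      have h2 := hr2 k
      have h3 := hr1 h
      have h4 : (r k : ℝ) * L k ≤ (δ * r h) * L k := by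
        calc (r k : ℝ) * L k ≤ (1 + ε) * M := h2
          _ ≤ (1 + ε) * (r h * L h) := by gcongr
          _ = ((1 + ε) * L h) * r h := by ring
          _ ≤ (L k * δ) * r h := by gcongr
          _ = _ := by ring
      exact le_of_mul_le_mul_right h4 (hL0 k))
    (fun h => (hpq h).1) (fun h => (hpq h).2.1) hP0 hPZ hPd (fun h _ => hr1 h)
    (fun h _ => (hr3 h).trans (by gcongr))
    (by
      have h1 := one_le_L1 hP0 hPZ
      have h2 := Real.log_le_log (by linarith) hPL
      rw [Real.log_pow] at h2
      refine h2.trans ?_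
      have h3 : ((∑ h, r h : ℕ) : ℝ) ≤ m * (ρ * M) := by
        push_cast
        calc ∑ h, (r h : ℝ) ≤ ∑ h : Fin m, ρ * M := Finset.sum_le_sum fun h _ => hr3 h
          _ = _ := by simp
      calc ((∑ h, r h : ℕ) : ℝ) * lB ≤ m * (ρ * M) * lB := by gcongr
        _ = (m * ρ * lB) * M := by ring
        _ ≤ δ * M := by gcongr)
  refine core hm α κ θ ε B M hκ0 hε0 hB hM0 hmain r hr0 (fun h => p h) (fun h => q h)
    (fun h => (hpq h).1) P hPZ hPd hPL hPv hr1 hr2 ?_ (fun h => (hpq h).2.2) a haw hac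
  intro h
  calc (r h : ℝ) * lG ≤ (ρ * M) * lG := by gcongr; exact hr3 h
    _ = (ρ * lG) * M := by ring
    _ ≤ ε * M := by gcongr

end RothAux

namespace RothAux

lemma small_denoms (z : ℝ) (hz : Irrational z) (N : ℕ) :
    ∃ c > 0, ∀ q : ℕ, 0 < q → q < N → ∀ p : ℤ, c ≤ |(q : ℝ) * z - p| := by
  induction N with
  | zero => exact ⟨1, one_pos, fun q _ h => absurd h (Nat.not_lt_zero q)⟩
  | succ N ih =>
    obtain ⟨c, hc, h⟩ := ih
    by_cases hN : N = 0
    · exact ⟨1, one_pos, fun q h1 h2 => by omega⟩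
    have hirr : Irrational ((N : ℝ) * z) := by
      have := hz.natCast_mul hN
      exact this
    have hpos : 0 < |(N : ℝ) * z - round ((N : ℝ) * z)| := by
      rw [abs_pos, sub_ne_zero]
      exact hirr.ne_int _
    refine ⟨min c |(N : ℝ) * z - round ((N : ℝ) * z)|, lt_min hc hpos, ?_⟩
    intro q h1 h2 p
    rcases Nat.lt_succ_iff_lt_or_eq.mp h2 with h3 | h3
    · exact (min_le_left _ _).trans (h q h1 h3 p)
    · rw [h3]
      exact (min_le_right _ _).trans (round_le _ p)

lemma roth_all (z : ℝ) (hz : Irrational z) (halg : IsAlgebraic ℚ z) (κ : ℝ) (hκ : 2 < κ) :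
    ∃ c > 0, ∀ (p : ℤ) (q : ℕ), 0 < q → c * (q : ℝ) ^ (-κ) ≤ |z - p / q| := by
  obtain ⟨Y, hY⟩ := roth z halg κ hκ
  obtain ⟨c, hc, hsmall⟩ := small_denoms z hz (⌈Real.exp Y⌉₊)
  have key : ∀ (p : ℤ) (q : ℕ), 0 < q → IsCoprime p (q : ℤ) →
      min c 1 * (q : ℝ) ^ (-κ) ≤ |z - p / q| := by
    intro p q hq hpq
    have hq' : (0 : ℝ) < q := by exact_mod_cast hq
    have hq1 : (1 : ℝ) ≤ q := by exact_mod_cast hq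
    by_cases hle : Y ≤ Real.log q
    · have h1 := (hY p q hq hpq hle).le
      have h2 : Real.exp (-κ * Real.log q) = (q : ℝ) ^ (-κ) := by
        rw [Real.rpow_def_of_pos hq', mul_comm]
      rw [h2] at h1
      refine le_trans ?_ h1
      have h3 : 0 ≤ (q : ℝ) ^ (-κ) := by positivity
      nlinarith [min_le_right c 1]
    · have hlt : q < ⌈Real.exp Y⌉₊ := by
        rw [Nat.lt_ceil, ← Real.log_lt_iff_lt_exp hq']
        exact not_le.mp hle
      have h1 := hsmall q hq hlt p
      have h2 : |z - p / q| = |(q : ℝ) * z - p| / q := by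
        rw [← abs_of_pos hq', ← abs_div, abs_of_pos hq']
        congr 1
        field_simp
      rw [h2, le_div_iff₀ hq']
      have h3 : (q : ℝ) ^ (-κ) * q ≤ 1 := by
        have : (q : ℝ) ^ (-κ) * q = (q : ℝ) ^ (-κ + 1) := by
          rw [Real.rpow_add hq', Real.rpow_one]
        rw [this]
        exact Real.rpow_le_one_of_one_le_of_nonpos hq1 (by linarith)
      have h4 : 0 ≤ (q : ℝ) ^ (-κ) * q := by positivity
      have h5 : 0 < min c 1 := by positivity
      calc min c 1 * (q : ℝ) ^ (-κ) * q = min c 1 * ((q : ℝ) ^ (-κ) * q) := by ring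
        _ ≤ min c 1 * 1 := by gcongr
        _ ≤ c := by rw [mul_one]; exact min_le_left _ _
        _ ≤ _ := h1
  refine ⟨min c 1, by positivity, ?_⟩
  intro p q hq
  have hq' : (0 : ℝ) < q := by exact_mod_cast hq
  set x : ℚ := (p : ℚ) / q with hx
  have hxr : (p : ℝ) / q = (x.num : ℝ) / x.den := by
    have h1 : ((x : ℚ) : ℝ) = (p : ℝ) / q := by rw [hx]; push_cast; rfl
    rw [← h1, Rat.cast_def]
  have hcop : IsCoprime x.num (x.den : ℤ) := by
    rw [Int.isCoprime_iff_gcd_eq_one]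
    exact x.reduced
  have hden : x.den ≤ q := by
    have h1 : (x.den : ℤ) ∣ (q : ℤ) := by
      have := Rat.den_dvd p q
      rwa [Rat.divInt_eq_div, Int.cast_natCast] at this
    exact Nat.le_of_dvd hq (by exact_mod_cast h1)
  rw [hxr]
  refine le_trans ?_ (key x.num x.den x.den_pos hcop)
  have hd' : (0 : ℝ) < x.den := by exact_mod_cast x.den_pos
  have : (q : ℝ) ^ (-κ) ≤ (x.den : ℝ) ^ (-κ) :=
    Real.rpow_le_rpow_of_nonpos hd' (by exact_mod_cast hden) (by linarith)
  gcongr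

lemma cos_lower (x : ℝ) : ∃ k : ℤ, |2 * x - (2 * k + 1)| ≤ |Real.cos (Real.pi * x)| := by
  refine ⟨⌊x⌋, ?_⟩
  set u := x - ⌊x⌋ - 1 / 2 with hu
  have hu1 : |u| ≤ 1 / 2 := by
    rw [abs_le]
    constructor <;> linarith [Int.floor_le x, Int.lt_floor_add_one x]
  have hpi := Real.pi_pos
  have h1 : Real.cos (Real.pi * x) = (-1) ^ ⌊x⌋ * -Real.sin (Real.pi * u) := by
    have h2 : Real.pi * x = (Real.pi * u + Real.pi / 2) + ⌊x⌋ * Real.pi := by rw [hu]; ring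
    rw [h2, Real.cos_add_int_mul_pi, Real.cos_add_pi_div_two]
  have h3 : |Real.cos (Real.pi * x)| = |Real.sin (Real.pi * u)| := by
    rw [h1, abs_mul, abs_neg, abs_zpow]
    simp
  have h4 : |Real.pi * u| ≤ Real.pi / 2 := by
    rw [abs_mul, abs_of_pos hpi]; nlinarith
  have h5 := Real.mul_abs_le_abs_sin h4
  rw [h3]
  refine le_trans (le_of_eq ?_) h5
  rw [abs_mul, abs_of_pos hpi]
  have h6 : 2 * x - (2 * ⌊x⌋ + 1) = 2 * u := by rw [hu]; ring
  rw [h6, abs_mul]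
  field_simp
  simp [mul_comm]

end RothAux

open Real

theorem secant_zeta_abs_convergence_algebraic (z : ℝ) (hirr : Irrational z)
    (halg : IsAlgebraic ℚ z) (s : ℝ) (hs : 2 < s) :
    Summable (fun n : ℕ => |1 / Real.cos (π * ((n : ℝ) + 1) * z)| / ((n : ℝ) + 1) ^ s) := by
  set κ := 2 + (s - 2) / 2 with hκ
  obtain ⟨c, hc, hroth⟩ := RothAux.roth_all z hirr halg κ (by linarith)
  have hsum : Summable (fun n : ℕ => (2 ^ (κ - 1) / c) * (1 / |(n : ℝ) + 1| ^ (s + 1 - κ))) :=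
    ((Real.summable_one_div_nat_add_rpow 1 (s + 1 - κ)).mpr (by rw [hκ]; linarith)).mul_left _
  refine Summable.of_nonneg_of_le (fun n => by positivity) (fun n => ?_) hsum
  set N : ℝ := (n : ℝ) + 1 with hN
  have hN0 : 0 < N := by positivity
  obtain ⟨k, hk⟩ := RothAux.cos_lower (N * z)
  rw [← mul_assoc π] at hk
  have h1 := hroth (2 * k + 1) (2 * (n + 1)) (by omega)
  have hcast : ((2 * (n + 1) : ℕ) : ℝ) = 2 * N := by rw [hN]; push_cast; ring
  rw [hcast] at h1
  have h2N : 0 < 2 * N := by positivity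
  have h2 : |2 * (N * z) - (2 * k + 1)| = (2 * N) * |z - ((2 * k + 1 : ℤ) : ℝ) / (2 * N)| := by
    rw [← abs_of_pos h2N, ← abs_mul, abs_of_pos h2N]
    congr 1
    push_cast
    field_simp
  have h3 : c * (2 * N) ^ (1 - κ) ≤ |Real.cos (π * N * z)| := by
    refine le_trans ?_ hk
    rw [h2]
    calc c * (2 * N) ^ (1 - κ) = (2 * N) * (c * (2 * N) ^ (-κ)) := by
          rw [sub_eq_add_neg, Real.rpow_add h2N, Real.rpow_one]; ring
      _ ≤ _ := by gcongr
  have h4 : 0 < c * (2 * N) ^ (1 - κ) := by positivity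
  rw [abs_div, abs_one, abs_of_pos hN0]
  calc 1 / |Real.cos (π * N * z)| / N ^ s ≤ 1 / (c * (2 * N) ^ (1 - κ)) / N ^ s := by gcongr
    _ = (2 ^ (κ - 1) / c) * (1 / N ^ (s + 1 - κ)) := by
        have h5 : s + 1 - κ = s + (1 - κ) := by ring
        have h6 : κ - 1 = -(1 - κ) := by ring
        rw [Real.mul_rpow (by norm_num) hN0.le, h5, Real.rpow_add hN0, h6,
          Real.rpow_neg (by norm_num)]
        field_simp
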